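/- Asymptotically flat truncation (Appendix A): There exists U_min < 0, with |U_min| small depending only on the self-similar solution, and a solution (r,m,φ) of SSESF on Q^(trunc) = {U_min ≤ U < 0, 1 ≤ V < ∞}, C¹ away from {U = 0}, attaining the truncated characteristic data, such that: r ≍ V, −∂_U r ≍ 1, ∂_V r ≍ 1, and 0 ≤ μ ≤ c′ < 1 on Q^(trunc); |∂_V r(U,V) − 1/2| ≲ V^{−2} and |∂_V(rφ)(U,V)| ≲ V^{−2}; for each U the limit ν_∞(U) = lim_{V→∞} ∂_U r(U,V) exists, is finite, is bounded between two negative constants uniformly in U, and |∂_U r(U,V) − ν_∞(U)| ≲ V^{−1}; along each {U = const}: r → ∞ and m, rφ have finite limits as V → ∞ (asymptotic flatness); and null infinity is incomplete: with Ω² = −4·∂_U r·∂_V r/(1−μ), limsup_{V→∞} ∫_{U_min}^0 Ω²(U,V) dU < ∞. -/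

import Mathlib

open Filter Topology Set MeasureTheory

noncomputable section

/-- partial derivative in the first (ingoing `U`) null coordinate -/
def pu (f : ℝ × ℝ → ℝ) (p : ℝ × ℝ) : ℝ := deriv (fun x => f (x, p.2)) p.1

/-- partial derivative in the second (outgoing `V`) null coordinate -/
def pv (f : ℝ × ℝ → ℝ) (p : ℝ × ℝ) : ℝ := deriv (fun y => f (p.1, y)) p.2

/-- the spherically symmetric Einstein–scalar field system SSESF in the `(U,V)` gauge -/
def SSESF (r m φ : ℝ × ℝ → ℝ) (S : Set (ℝ × ℝ)) : Prop :=
  ∀ p ∈ S,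
    pu (pv r) p = 2 * m p / r p * pv r p * pu r p / ((1 - 2 * m p / r p) * r p) ∧
    pv (pu r) p = 2 * m p / r p * pv r p * pu r p / ((1 - 2 * m p / r p) * r p) ∧
    r p * pu (pv φ) p = -(pu r p) * pv φ p - pv r p * pu φ p ∧
    2 * pu r p * pu m p = r p ^ 2 * (1 - 2 * m p / r p) * (pu φ p) ^ 2 ∧
    2 * pv r p * pv m p = r p ^ 2 * (1 - 2 * m p / r p) * (pv φ p) ^ 2

/-- the region `{V ≥ 1, z ≥ 1}` on which the exact `k`-self-similar exterior solution
is assumed to satisfy self-similar bounds; `z = V/(−U)^{1/(1−k²)}` is the self-similar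
coordinate -/
def RegSS (k : ℝ) : Set (ℝ × ℝ) :=
  {q : ℝ × ℝ | -1 ≤ q.1 ∧ q.1 < 0 ∧ 1 ≤ q.2 ∧
    1 ≤ q.2 / (-q.1) ^ ((1 : ℝ) / (1 - k ^ 2))}

/-- The Banach algebra of continuous functions on the compactified outgoing cone, where
`s = 1 - 1 / V ∈ [0, 1]`. -/
abbrev ConeFun := C(unitInterval, ℝ)

namespace ConeFun

/-- The restriction of the real line to `[0, 1]`. -/
abbrev clampI (s : ℝ) : unitInterval := projIcc 0 1 zero_le_one s

/-- The primitive `∫₀^σ x`, where `x` is extended by constants outside `[0, 1]`. -/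
def prim (x : ConeFun) (σ : ℝ) : ℝ := ∫ t in (0 : ℝ)..σ, x (clampI t)

lemma continuous_ext (x : ConeFun) : Continuous fun t => x (clampI t) :=
  x.continuous.comp continuous_projIcc

lemma abs_apply_le (x : ConeFun) (s : unitInterval) : |x s| ≤ ‖x‖ := x.norm_coe_le_norm s

lemma hasDerivAt_prim (x : ConeFun) (σ : ℝ) : HasDerivAt (prim x) (x (clampI σ)) σ :=
  intervalIntegral.integral_hasDerivAt_right (x.continuous_ext.intervalIntegrable _ _)
    (x.continuous_ext.stronglyMeasurableAtFilter _ _) x.continuous_ext.continuousAt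

lemma prim_zero (x : ConeFun) : prim x 0 = 0 := by simp [prim]

lemma prim_sub_le (x : ConeFun) (σ σ' : ℝ) : |prim x σ - prim x σ'| ≤ ‖x‖ * |σ - σ'| := by
  rw [prim, prim, intervalIntegral.integral_interval_sub_left
    (x.continuous_ext.intervalIntegrable _ _) (x.continuous_ext.intervalIntegrable _ _)]
  exact intervalIntegral.norm_integral_le_of_norm_le_const fun t _ => x.norm_coe_le_norm _

lemma abs_prim_le (x : ConeFun) (σ : ℝ) : |prim x σ| ≤ ‖x‖ * |σ| := by
  simpa [prim_zero] using prim_sub_le x σ 0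

lemma prim_add (x y : ConeFun) (σ : ℝ) : prim (x + y) σ = prim x σ + prim y σ :=
  intervalIntegral.integral_add (x.continuous_ext.intervalIntegrable _ _)
    (y.continuous_ext.intervalIntegrable _ _)

lemma prim_smul (c : ℝ) (x : ConeFun) (σ : ℝ) : prim (c • x) σ = c * prim x σ :=
  intervalIntegral.integral_const_mul _ _

/-- `prim` at a fixed endpoint, as a functional. -/
def primL (σ : ℝ) : ConeFun →L[ℝ] ℝ :=
  LinearMap.mkContinuous
    { toFun := fun x => prim x σ
      map_add' := fun x y => prim_add x y σ
      map_smul' := fun c x => prim_smul c x σ } |σ| fun x => by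
    simpa [mul_comm] using abs_prim_le x σ

@[simp] lemma primL_apply (σ : ℝ) (x : ConeFun) : primL σ x = prim x σ := rfl

/-- Evaluation at a clamped real number, as a functional. -/
def evalL (σ : ℝ) : ConeFun →L[ℝ] ℝ :=
  LinearMap.mkContinuous
    { toFun := fun x => x (clampI σ)
      map_add' := fun _ _ => rfl
      map_smul' := fun _ _ => rfl } 1 fun x => by simpa using x.abs_apply_le _

lemma continuous_primL : Continuous primL := by
  refine (LipschitzWith.of_dist_le_mul (f := primL) (K := 1) fun σ σ' => ?_).continuous
  rw [dist_eq_norm (primL σ)]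
  refine ContinuousLinearMap.opNorm_le_bound _ (by positivity) fun x => ?_
  rw [sub_apply, primL_apply, primL_apply, NNReal.coe_one, one_mul,
    Real.dist_eq, mul_comm]
  exact prim_sub_le x σ σ'

lemma contDiff_prim : ContDiff ℝ 1 (fun p : ConeFun × ℝ => prim p.1 p.2) := by
  rw [contDiff_one_iff_hasFDerivAt]
  let f₁ : ConeFun → ℝ → ConeFun →L[ℝ] ℝ := fun _ σ => primL σ
  let f₂ : ConeFun → ℝ → ℝ →L[ℝ] ℝ := fun x σ =>
    ContinuousLinearMap.toSpanSingleton ℝ (x (clampI σ))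
  have c₁ : Continuous (fun p : ConeFun × ℝ => f₁ p.1 p.2) := continuous_primL.comp continuous_snd
  have c₂ : Continuous (fun p : ConeFun × ℝ => f₂ p.1 p.2) := by
    have h : Continuous (fun p : ConeFun × ℝ => p.1 (clampI p.2)) :=
      continuous_fst.eval (continuous_projIcc.comp continuous_snd)
    exact (ContinuousLinearMap.toSpanSingletonCLE (𝕜 := ℝ) (E := ℝ)).continuous.comp h
  refine ⟨fun p => (f₁ p.1 p.2).coprod (f₂ p.1 p.2), ?_, fun p => ?_⟩
  · exact (ContinuousLinearMap.coprodEquivL (𝕜 := ℝ) (E := ConeFun) (F := ℝ)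
      (G := ℝ) ℝ).continuous.comp (c₁.prodMk c₂)
  · refine (hasStrictFDerivAt_uncurry_coprod (f := prim) (f₁ := f₁) (f₂ := f₂) ?_ ?_
      c₁.continuousAt c₂.continuousAt).hasFDerivAt
    · exact .of_forall fun v => (primL v.2).hasFDerivAt
    · exact .of_forall fun v => (hasDerivAt_prim v.1 v.2).hasFDerivAt

/-- The primitive as an operator on `ConeFun`. -/
def primOp : ConeFun →L[ℝ] ConeFun :=
  LinearMap.mkContinuous
    { toFun := fun x => ⟨fun s => prim x s,
        (continuous_iff_continuousAt.2 fun σ => (hasDerivAt_prim x σ).continuousAt).comp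
          continuous_subtype_val⟩
      map_add' := fun x y => by ext s; exact prim_add x y s
      map_smul' := fun c x => by ext s; exact prim_smul c x s } 1 fun x => by
    rw [one_mul, ContinuousMap.norm_le _ (norm_nonneg _)]
    intro s
    refine (abs_prim_le x s).trans (mul_le_of_le_one_right (norm_nonneg _) ?_)
    rw [abs_of_nonneg s.2.1]; exact s.2.2

@[simp] lemma primOp_apply (x : ConeFun) (s : unitInterval) : primOp x s = prim x s := rfl

lemma norm_primOp_le (x : ConeFun) : ‖primOp x‖ ≤ ‖x‖ := by
  simpa using (LinearMap.mkContinuous_norm_le _ zero_le_one _ : ‖primOp‖ ≤ 1) |>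
    fun h => primOp.le_of_opNorm_le h x

lemma exp_apply (x : ConeFun) (s : unitInterval) : NormedSpace.exp x s = Real.exp (x s) := by
  have := NormedSpace.map_exp_of_mem_ball (𝕂 := ℝ)
    (ContinuousMap.evalAlgHom ℝ ℝ s : ConeFun →ₐ[ℝ] ℝ)
    (continuous_eval_const s) x
    (by rw [NormedSpace.expSeries_radius_eq_top]; exact edist_lt_top _ _)
  rw [Real.exp_eq_exp_ℝ]
  exact this

lemma contDiff_exp : ContDiff ℝ 1 (NormedSpace.exp : ConeFun → ConeFun) :=
  contDiff_iff_contDiffAt.2 fun x => (NormedSpace.exp_analytic (𝕂 := ℝ) x).contDiffAt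

lemma isUnit_of_le {κ : ℝ} (hκ : 0 < κ) {x : ConeFun} (h : ∀ s, κ ≤ x s) : IsUnit x :=
  (ContinuousMap.isUnit_iff_forall_ne_zero x).2 fun s => (hκ.trans_le (h s)).ne'

lemma inverse_apply {κ : ℝ} (hκ : 0 < κ) {x : ConeFun} (h : ∀ s, κ ≤ x s) (s : unitInterval) :
    Ring.inverse x s = (x s)⁻¹ := by
  have h1 : x s * Ring.inverse x s = 1 := by
    rw [← ContinuousMap.mul_apply, Ring.mul_inverse_cancel _ (isUnit_of_le hκ h)]; rfl
  exact eq_inv_of_mul_eq_one_right h1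

end ConeFun

open ConeFun

/-- A map of time and state into `ConeFun` that is continuous in time, and bounded and Lipschitz
in the state, uniformly over the states in `S` and the times in `[-1, 0]`. -/
structure Tame (S : Set (ConeFun × ConeFun)) (G : ℝ → ConeFun × ConeFun → ConeFun) : Prop where
  bdd : ∃ B, 0 ≤ B ∧ ∀ t ∈ Icc (-1 : ℝ) 0, ∀ x ∈ S, ‖G t x‖ ≤ B
  lip : ∃ K, 0 ≤ K ∧ ∀ t ∈ Icc (-1 : ℝ) 0, ∀ x ∈ S, ∀ y ∈ S, ‖G t x - G t y‖ ≤ K * ‖x - y‖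
  cont : ∀ x ∈ S, ContinuousOn (fun t => G t x) (Icc (-1) 0)

namespace Tame

variable {S : Set (ConeFun × ConeFun)} {G H : ℝ → ConeFun × ConeFun → ConeFun}

lemma of_time {c : ℝ → ℝ} (hc : ContinuousOn c (Icc (-1) 0)) (a : ConeFun) :
    Tame S (fun t _ => c t • a) where
  bdd := by
    obtain ⟨B, hB⟩ := (isCompact_Icc (a := (-1 : ℝ)) (b := 0)).exists_bound_of_continuousOn
      (f := fun t => c t • a) (by fun_prop)
    exact ⟨|B|, abs_nonneg B, fun t ht _ _ => (hB t ht).trans (le_abs_self B)⟩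
  lip := ⟨0, le_rfl, by simp⟩
  cont _ _ := by fun_prop

lemma const (a : ConeFun) : Tame S (fun _ _ => a) := by
  simpa using of_time (S := S) (c := fun _ => 1) continuousOn_const a

lemma add (hG : Tame S G) (hH : Tame S H) : Tame S (fun t x => G t x + H t x) where
  bdd := by
    obtain ⟨B, hB, h⟩ := hG.bdd
    obtain ⟨B', hB', h'⟩ := hH.bdd
    exact ⟨B + B', by positivity, fun t ht x hx => norm_add_le_of_le (h t ht x hx) (h' t ht x hx)⟩
  lip := by
    obtain ⟨K, hK, h⟩ := hG.lip
    obtain ⟨K', hK', h'⟩ := hH.lip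
    refine ⟨K + K', by positivity, fun t ht x hx y hy => ?_⟩
    rw [add_sub_add_comm, add_mul]
    exact norm_add_le_of_le (h t ht x hx y hy) (h' t ht x hx y hy)
  cont x hx := (hG.cont x hx).add (hH.cont x hx)

lemma mul (hG : Tame S G) (hH : Tame S H) : Tame S (fun t x => G t x * H t x) where
  bdd := by
    obtain ⟨B, hB, h⟩ := hG.bdd
    obtain ⟨B', hB', h'⟩ := hH.bdd
    exact ⟨B * B', by positivity, fun t ht x hx =>
      norm_mul_le_of_le (h t ht x hx) (h' t ht x hx)⟩
  lip := by
    obtain ⟨B, hB, b⟩ := hG.bdd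
    obtain ⟨B', hB', b'⟩ := hH.bdd
    obtain ⟨K, hK, h⟩ := hG.lip
    obtain ⟨K', hK', h'⟩ := hH.lip
    refine ⟨K * B' + B * K', by positivity, fun t ht x hx y hy => ?_⟩
    calc ‖G t x * H t x - G t y * H t y‖
        = ‖(G t x - G t y) * H t x + G t y * (H t x - H t y)‖ := by congr 1; ring
      _ ≤ (K * ‖x - y‖) * B' + B * (K' * ‖x - y‖) :=
          norm_add_le_of_le (norm_mul_le_of_le (h t ht x hx y hy) (b' t ht x hx))
            (norm_mul_le_of_le (b t ht y hy) (h' t ht x hx y hy))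
      _ = (K * B' + B * K') * ‖x - y‖ := by ring
  cont x hx := (hG.cont x hx).mul (hH.cont x hx)

lemma time_smul {c : ℝ → ℝ} (hc : ContinuousOn c (Icc (-1) 0)) (hG : Tame S G) :
    Tame S (fun t x => c t • G t x) := by
  simpa using (of_time (S := S) hc 1).mul hG

lemma sub (hG : Tame S G) (hH : Tame S H) : Tame S (fun t x => G t x - H t x) := by
  simpa [sub_eq_add_neg] using hG.add (time_smul (c := fun _ => -1) continuousOn_const hH)

lemma sq (hG : Tame S G) : Tame S (fun t x => G t x ^ 2) := by
  simpa only [pow_two] using hG.mul hG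

lemma primOp (hG : Tame S G) : Tame S (fun t x => primOp (G t x)) where
  bdd := by
    obtain ⟨B, hB, h⟩ := hG.bdd
    exact ⟨B, hB, fun t ht x hx => (norm_primOp_le _).trans (h t ht x hx)⟩
  lip := by
    obtain ⟨K, hK, h⟩ := hG.lip
    refine ⟨K, hK, fun t ht x hx y hy => ?_⟩
    rw [← map_sub]
    exact (norm_primOp_le _).trans (h t ht x hx y hy)
  cont x hx := ConeFun.primOp.continuous.comp_continuousOn (hG.cont x hx)

lemma exp (hG : Tame S G) : Tame S (fun t x => NormedSpace.exp (G t x)) where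
  bdd := by
    obtain ⟨B, hB, h⟩ := hG.bdd
    refine ⟨Real.exp B, by positivity, fun t ht x hx => ?_⟩
    rw [ContinuousMap.norm_le _ (by positivity)]
    intro s
    rw [exp_apply, Real.norm_eq_abs, Real.abs_exp, Real.exp_le_exp]
    exact (le_abs_self _).trans ((abs_apply_le _ s).trans (h t ht x hx))
  lip := by
    obtain ⟨B, hB, b⟩ := hG.bdd
    obtain ⟨K, hK, h⟩ := hG.lip
    refine ⟨Real.exp B * K, by positivity, fun t ht x hx y hy => ?_⟩
    rw [ContinuousMap.norm_le _ (by positivity)]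
    intro s
    have hs : ∀ z ∈ S, G t z s ∈ Iic B := fun z hz =>
      (le_abs_self _).trans ((abs_apply_le _ s).trans (b t ht z hz))
    have := (convex_Iic B).norm_image_sub_le_of_norm_deriv_le (f := Real.exp) (C := Real.exp B)
      (fun u _ => Real.differentiableAt_exp) (fun u hu => by simpa using hu) (hs y hy) (hs x hx)
    rw [ContinuousMap.sub_apply, exp_apply, exp_apply, mul_assoc]
    refine this.trans (mul_le_mul_of_nonneg_left ?_ (Real.exp_pos B).le)
    exact (abs_apply_le (G t x - G t y) s).trans (h t ht x hx y hy)
  cont x hx := contDiff_exp.continuous.comp_continuousOn (hG.cont x hx)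

lemma norm_inverse_le {κ : ℝ} (hκ : 0 < κ) {a : ConeFun} (h : ∀ s, κ ≤ a s) :
    ‖Ring.inverse a‖ ≤ κ⁻¹ := by
  rw [ContinuousMap.norm_le _ (by positivity)]
  intro s
  rw [inverse_apply hκ h, Real.norm_eq_abs, abs_inv, abs_of_pos (hκ.trans_le (h s))]
  exact inv_anti₀ hκ (h s)

lemma inverse {κ : ℝ} (hκ : 0 < κ) (hG : Tame S G)
    (hpos : ∀ t ∈ Icc (-1 : ℝ) 0, ∀ x ∈ S, ∀ s, κ ≤ G t x s) :
    Tame S (fun t x => Ring.inverse (G t x)) where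
  bdd := ⟨κ⁻¹, by positivity, fun t ht x hx => norm_inverse_le hκ (hpos t ht x hx)⟩
  lip := by
    obtain ⟨K, hK, h⟩ := hG.lip
    refine ⟨κ⁻¹ * K * κ⁻¹, by positivity, fun t ht x hx y hy => ?_⟩
    have hx' := isUnit_of_le hκ (hpos t ht x hx)
    have hy' := isUnit_of_le hκ (hpos t ht y hy)
    calc ‖Ring.inverse (G t x) - Ring.inverse (G t y)‖
        = ‖Ring.inverse (G t x) * (G t y - G t x) * Ring.inverse (G t y)‖ := by
          congr 1
          rw [mul_sub, sub_mul, mul_assoc, Ring.mul_inverse_cancel _ hy',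
            Ring.inverse_mul_cancel _ hx', mul_one, one_mul]
      _ ≤ κ⁻¹ * (K * ‖x - y‖) * κ⁻¹ := by
          refine norm_mul_le_of_le (norm_mul_le_of_le (norm_inverse_le hκ (hpos t ht x hx)) ?_)
            (norm_inverse_le hκ (hpos t ht y hy))
          rw [norm_sub_rev]
          exact h t ht x hx y hy
      _ = κ⁻¹ * K * κ⁻¹ * ‖x - y‖ := by ring
  cont x hx t ht := by
    obtain ⟨u, hu⟩ := isUnit_of_le hκ (hpos t ht x hx)
    have : ContinuousAt Ring.inverse (G t x) := hu ▸ NormedRing.inverse_continuousAt u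
    exact this.comp_continuousWithinAt (f := fun t => G t x) (hG.cont x hx t ht)

lemma proj {f : ConeFun × ConeFun → ConeFun} {B : ℝ} (hf : ∀ x y, ‖f x - f y‖ ≤ ‖x - y‖)
    (hB : ∀ x ∈ S, ‖f x‖ ≤ B) : Tame S (fun _ x => f x) where
  bdd := ⟨|B|, abs_nonneg B, fun _ _ x hx => (hB x hx).trans (le_abs_self B)⟩
  lip := ⟨1, zero_le_one, fun _ _ x _ y _ => by simpa using hf x y⟩
  cont _ _ := continuousOn_const

/-- A tame map is continuous along continuous curves in `S`. -/
lemma continuousOn_curve (hG : Tame S G) {X : ℝ → ConeFun × ConeFun} {T : Set ℝ}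
    (hT : T ⊆ Icc (-1) 0) (hX : ContinuousOn X T) (hXS : ∀ t ∈ T, X t ∈ S) :
    ContinuousOn (fun t => G t (X t)) T := by
  obtain ⟨K, hK, h⟩ := hG.lip
  have := continuousOn_prod_of_continuousOn_lipschitzOnWith' (s := Icc (-1 : ℝ) 0) (t := S)
    (fun p : ℝ × (ConeFun × ConeFun) => G p.1 p.2) K.toNNReal
    (fun t ht => LipschitzOnWith.of_dist_le_mul fun x hx y hy => by
      rw [dist_eq_norm (G t x), dist_eq_norm x, Real.coe_toNNReal K hK]
      exact h t ht x hx y hy) hG.cont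
  exact this.comp (continuousOn_id.prodMk hX) fun t ht => ⟨hT ht, hXS t ht⟩

end Tame

/-- Data on the ingoing cone `{V = 1}`, for `U ∈ [-1, 0]`: area radius `r`, its derivative `ν`,
scalar field `φ`, its derivative `b`, and Hawking mass `m`. -/
structure IngoingData where
  r : ℝ → ℝ
  ν : ℝ → ℝ
  φ : ℝ → ℝ
  b : ℝ → ℝ
  m : ℝ → ℝ
  κ : ℝ
  κ_pos : 0 < κ
  κ_le : κ ≤ 1 / 2
  cont_r : Continuous r
  cont_ν : Continuous ν
  cont_φ : Continuous φ
  cont_m : Continuous m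
  cont_b : ContinuousOn b (Ioo (-1) 0)
  r_ge : ∀ U ∈ Icc (-1 : ℝ) 0, κ ≤ r U
  m_nonneg : ∀ U ∈ Icc (-1 : ℝ) 0, 0 ≤ m U
  gap : ∀ U ∈ Icc (-1 : ℝ) 0, κ ≤ r U - 2 * m U
  ν_le : ∀ U ∈ Icc (-1 : ℝ) 0, κ ≤ -ν U
  deriv_r : ∀ U ∈ Ioo (-1 : ℝ) 0, HasDerivAt r (ν U) U
  deriv_φ : ∀ U ∈ Ioo (-1 : ℝ) 0, HasDerivAt φ (b U) U
  deriv_m : ∀ U ∈ Ioo (-1 : ℝ) 0,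
    HasDerivAt m ((r U - 2 * m U) * r U * b U ^ 2 / (2 * ν U)) U

/-- The function `1 / V`. -/
def tau : ConeFun := ⟨fun s => 1 - s, by fun_prop⟩

@[simp] lemma tau_apply (s : unitInterval) : tau s = 1 - s := rfl

/-- States `(ℓ, z)`, with `∂_V r = 1 / 2 + ℓ / V²` and `∂_V (r φ) = z / V²`, that are bounded by
`B` and have `∂_V r ≥ κ`. -/
def admissible (κ B : ℝ) : Set (ConeFun × ConeFun) :=
  {x | ‖x.1‖ ≤ B ∧ ‖x.2‖ ≤ B ∧ ∀ s : unitInterval, κ ≤ 1 / 2 + (1 - (s : ℝ)) ^ 2 * x.1 s}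

/-- `∂_V r`. -/
def lam (x : ConeFun × ConeFun) : ConeFun := (1 / 2 : ℝ) • (1 : ConeFun) + tau ^ 2 * x.1

@[simp] lemma lam_apply (x : ConeFun × ConeFun) (s : unitInterval) :
    lam x s = 1 / 2 + (1 - (s : ℝ)) ^ 2 * x.1 s := by simp [lam]

namespace IngoingData

variable (D : IngoingData)

/-- `∂_U r / (1 - μ)` on `{V = 1}`. -/
def γ (U : ℝ) : ℝ := D.ν U * D.r U / (D.r U - 2 * D.m U)

/-- `r / V`. -/
def rho (U : ℝ) (x : ConeFun × ConeFun) : ConeFun :=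
  tau * (D.r U • (1 : ConeFun) + primOp x.1) + (1 / 2 : ℝ) • (1 - tau)

/-- `r φ`. -/
def psi (U : ℝ) (x : ConeFun × ConeFun) : ConeFun :=
  (D.r U * D.φ U) • (1 : ConeFun) + primOp x.2

/-- `r V ∂_V φ`. -/
def tee (U : ℝ) (x : ConeFun × ConeFun) : ConeFun :=
  tau * x.2 - lam x * D.psi U x * Ring.inverse (D.rho U x)

/-- `V³ r (∂_V φ)² / ∂_V r`. -/
def beta (U : ℝ) (x : ConeFun × ConeFun) : ConeFun :=
  D.tee U x ^ 2 * Ring.inverse (D.rho U x) * Ring.inverse (lam x)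

/-- The integrating factor `exp (∫ r (∂_V φ)² / ∂_V r dV)`. -/
def gam (U : ℝ) (x : ConeFun × ConeFun) : ConeFun :=
  NormedSpace.exp (primOp (tau * D.beta U x))

/-- The Hawking mass multiplied by the integrating factor. -/
def wmass (U : ℝ) (x : ConeFun × ConeFun) : ConeFun :=
  D.m U • (1 : ConeFun) +
    (1 / 2 : ℝ) • primOp (D.gam U x * D.tee U x ^ 2 * Ring.inverse (lam x))

/-- `V² ∂_U ∂_V r`. -/
def accel (U : ℝ) (x : ConeFun × ConeFun) : ConeFun :=
  (2 * D.γ U) • (lam x * D.wmass U x * Ring.inverse (D.rho U x) ^ 2)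

/-- The right-hand side of the evolution equation in `U` for the state `(ℓ, z)`. -/
def field (U : ℝ) (x : ConeFun × ConeFun) : ConeFun × ConeFun :=
  (D.accel U x, tau * D.psi U x * Ring.inverse (D.rho U x) * D.accel U x)

lemma rho_apply (U : ℝ) (x : ConeFun × ConeFun) (s : unitInterval) :
    D.rho U x s = (1 - s) * (D.r U + prim x.1 s) + s / 2 := by
  simp [rho]; ring

variable {D} {B U : ℝ} {x : ConeFun × ConeFun}

lemma r_add_prim_ge {κ : ℝ} (hκ : ∀ s : unitInterval, κ ≤ lam x s) {σ : ℝ}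
    (h0 : 0 ≤ σ) (h1 : σ < 1) :
    κ * ((1 - σ)⁻¹ - 1) ≤ ((1 - σ)⁻¹ - 1) / 2 + prim x.1 σ := by
  have hd : ∀ y : ℝ, y < 1 → HasDerivAt
      (fun σ => ((1 - σ)⁻¹ - 1) / 2 + prim x.1 σ - κ * ((1 - σ)⁻¹ - 1))
      ((1 - y)⁻¹ ^ 2 * (1 / 2 - κ) + x.1 (clampI y)) y := by
    intro y hy
    have h : HasDerivAt (fun σ : ℝ => (1 - σ)⁻¹ - 1) ((1 - y)⁻¹ ^ 2) y := by
      refine ((((hasDerivAt_id y).const_sub 1).inv (by simp; linarith)).sub_const 1).congr_deriv ?_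
      simp [div_eq_mul_inv]
    refine (((h.div_const 2).add (hasDerivAt_prim x.1 y)).sub (h.const_mul κ)).congr_deriv ?_
    ring
  have hm := monotoneOn_of_deriv_nonneg (convex_Icc 0 σ)
    (f := fun σ => ((1 - σ)⁻¹ - 1) / 2 + prim x.1 σ - κ * ((1 - σ)⁻¹ - 1))
    (fun y hy => (hd y (hy.2.trans_lt h1)).continuousAt.continuousWithinAt)
    (fun y hy => by
      rw [interior_Icc] at hy
      exact (hd y (hy.2.trans h1)).differentiableAt.differentiableWithinAt)
    (fun y hy => by
      rw [interior_Icc] at hy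
      have hy1 : 0 < 1 - y := by linarith [hy.2]
      rw [(hd y (hy.2.trans h1)).deriv]
      have hc : (clampI y : ℝ) = y := by
        simp [clampI, projIcc_of_mem zero_le_one (show y ∈ Icc (0 : ℝ) 1 from
          ⟨hy.1.le, (hy.2.trans h1).le⟩)]
      have h2 := hκ (clampI y)
      rw [lam_apply, hc] at h2
      have : (1 - y)⁻¹ ^ 2 * (1 / 2 - κ) + x.1 (clampI y) =
          (1 - y)⁻¹ ^ 2 * (1 / 2 + (1 - y) ^ 2 * x.1 (clampI y) - κ) := by
        field_simp
        ring
      rw [this]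
      exact mul_nonneg (by positivity) (by linarith))
  have := hm ⟨le_rfl, h0⟩ ⟨h0, le_rfl⟩ h0
  simp only [prim_zero] at this
  norm_num at this
  linarith

lemma rho_sub_ge {κ c : ℝ} (hκ : ∀ s : unitInterval, κ ≤ lam x s) (hκ' : κ ≤ 1 / 2)
    (hc : κ ≤ D.r U - c) (s : unitInterval) : κ ≤ D.rho U x s - (1 - s) * c := by
  rw [rho_apply]
  rcases s.2.2.eq_or_lt with h | h
  · rw [h]; linarith
  · have h1 : 0 < 1 - (s : ℝ) := by linarith
    have := mul_le_mul_of_nonneg_left (r_add_prim_ge hκ s.2.1 h) h1.le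
    have e : (1 - (s : ℝ)) * (1 - (s : ℝ))⁻¹ = 1 := mul_inv_cancel₀ h1.ne'
    have h3 := mul_le_mul_of_nonneg_left hc h1.le
    have e1 : (1 - (s : ℝ)) * (κ * ((1 - (s : ℝ))⁻¹ - 1)) = κ * s := by
      linear_combination κ * e
    have e2 : (1 - (s : ℝ)) * (((1 - (s : ℝ))⁻¹ - 1) / 2 + prim x.1 s) =
        s / 2 + (1 - s) * prim x.1 s := by
      linear_combination e / 2
    rw [e1, e2] at this
    linarith

lemma lam_ge (hx : x ∈ admissible D.κ B) (s : unitInterval) : D.κ ≤ lam x s := by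
  simpa using hx.2.2 s

lemma rho_ge (hU : U ∈ Icc (-1 : ℝ) 0) (hx : x ∈ admissible D.κ B) (s : unitInterval) :
    D.κ ≤ D.rho U x s := by
  simpa using rho_sub_ge (c := 0) (lam_ge hx) D.κ_le (by simpa using D.r_ge U hU) s

lemma continuousOn_γ : ContinuousOn D.γ (Icc (-1) 0) :=
  (D.cont_ν.mul D.cont_r).continuousOn.div
    (D.cont_r.sub (continuous_const.mul D.cont_m)).continuousOn
    fun U hU => (D.κ_pos.trans_le (D.gap U hU)).ne'

variable (D B)

lemma tame_fst : Tame (admissible D.κ B) (fun _ x => x.1) :=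
  .proj (fun x y => (norm_fst_le (x - y))) fun _ hx => hx.1

lemma tame_snd : Tame (admissible D.κ B) (fun _ x => x.2) :=
  .proj (fun x y => (norm_snd_le (x - y))) fun _ hx => hx.2.1

lemma tame_lam : Tame (admissible D.κ B) (fun _ x => lam x) :=
  (Tame.const _).add ((Tame.const _).mul (D.tame_fst B))

lemma tame_inverse_lam : Tame (admissible D.κ B) (fun _ x => Ring.inverse (lam x)) :=
  (D.tame_lam B).inverse D.κ_pos fun _ _ _ hx => lam_ge hx

lemma tame_rho : Tame (admissible D.κ B) D.rho :=
  ((Tame.const _).mul ((Tame.of_time D.cont_r.continuousOn _).add (D.tame_fst B).primOp)).add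
    (Tame.const _)

lemma tame_inverse_rho : Tame (admissible D.κ B) (fun U x => Ring.inverse (D.rho U x)) :=
  (D.tame_rho B).inverse D.κ_pos fun _ hU _ hx => rho_ge hU hx

lemma tame_psi : Tame (admissible D.κ B) D.psi :=
  (Tame.of_time (D.cont_r.mul D.cont_φ).continuousOn _).add (D.tame_snd B).primOp

lemma tame_tee : Tame (admissible D.κ B) D.tee :=
  ((Tame.const _).mul (D.tame_snd B)).sub
    (((D.tame_lam B).mul (D.tame_psi B)).mul (D.tame_inverse_rho B))

lemma tame_beta : Tame (admissible D.κ B) D.beta :=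
  ((D.tame_tee B).sq.mul (D.tame_inverse_rho B)).mul (D.tame_inverse_lam B)

lemma tame_gam : Tame (admissible D.κ B) D.gam :=
  ((Tame.const _).mul (D.tame_beta B)).primOp.exp

lemma tame_wmass : Tame (admissible D.κ B) D.wmass :=
  (Tame.of_time D.cont_m.continuousOn _).add
    ((((D.tame_gam B).mul (D.tame_tee B).sq).mul (D.tame_inverse_lam B)).primOp.time_smul
      (c := fun _ => 1 / 2) continuousOn_const)

lemma tame_accel : Tame (admissible D.κ B) D.accel :=
  (((D.tame_lam B).mul (D.tame_wmass B)).mul (D.tame_inverse_rho B).sq).time_smul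
    (continuousOn_const.mul continuousOn_γ)

lemma tame_field_snd : Tame (admissible D.κ B) (fun U x => (D.field U x).2) :=
  (((Tame.const _).mul (D.tame_psi B)).mul (D.tame_inverse_rho B)).mul (D.tame_accel B)

end IngoingData

/-- A solution provided by the Picard-Lindelöf theorem that stays in the closed ball on which the
vector field is controlled. -/
lemma IsPicardLindelof.exists_curve_mem_closedBall {E : Type*} [NormedAddCommGroup E]
    [NormedSpace ℝ E] [CompleteSpace E] {f : ℝ → E → E} {tmin tmax : ℝ} {t₀ : Icc tmin tmax}
    {x₀ : E} {a L K : NNReal} (hf : IsPicardLindelof f t₀ x₀ a 0 L K) :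
    ∃ X : ℝ → E, X t₀ = x₀ ∧ (∀ t, X t ∈ Metric.closedBall x₀ a) ∧
      ∀ t ∈ Ioo tmin tmax, HasDerivAt X (f t (X t)) t := by
  have hx : x₀ ∈ Metric.closedBall x₀ ((0 : NNReal) : ℝ) := by simp
  obtain ⟨α, hα⟩ := ODE.FunSpace.exists_isFixedPt_next hf hx
  rw [ODE.FunSpace.isFixedPt_next_iff] at hα
  refine ⟨α.compProj, ?_, fun t => α.compProj_mem_closedBall hf.mul_max_le, fun t ht => ?_⟩
  · rw [ODE.FunSpace.compProj_val, ODE.FunSpace.apply_of_zero]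
  · have h := ODE.hasDerivWithinAt_picard_Icc t₀.2 hf.continuousOn_uncurry
      α.continuous_compProj.continuousOn (fun t _ => α.compProj_mem_closedBall hf.mul_max_le) x₀
      (Ioo_subset_Icc_self ht)
    refine (h.hasDerivAt (Icc_mem_nhds ht.1 ht.2)).congr_of_eventuallyEq ?_
    filter_upwards [Icc_mem_nhds ht.1 ht.2] with t' ht'
    rw [ODE.FunSpace.compProj_of_mem ht', hα]

namespace IngoingData

variable (D : IngoingData)

lemma closedBall_subset_admissible {B : ℝ} {x : ConeFun × ConeFun}
    (hx : x ∈ admissible (2 * D.κ) B) :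
    Metric.closedBall x D.κ ⊆ admissible D.κ (B + 1) := by
  intro y hy
  rw [mem_closedBall_iff_norm] at hy
  have h1 := (norm_fst_le (y - x)).trans hy
  have h2 := (norm_snd_le (y - x)).trans hy
  have hκ := D.κ_le
  have n1 : ‖y.1‖ ≤ ‖x.1‖ + ‖(y - x).1‖ := by
    simpa using norm_add_le x.1 (y - x).1
  have n2 : ‖y.2‖ ≤ ‖x.2‖ + ‖(y - x).2‖ := by
    simpa using norm_add_le x.2 (y - x).2
  refine ⟨by linarith [hx.1], by linarith [hx.2.1], fun s => ?_⟩
  have h3 : |y.1 s - x.1 s| ≤ D.κ := ((y - x).1.abs_apply_le s).trans h1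
  have h4 : (1 - (s : ℝ)) ^ 2 ≤ 1 := by
    have := s.2.1; have := s.2.2
    nlinarith
  have h5 := hx.2.2 s
  have h6 : |(1 - (s : ℝ)) ^ 2 * (y.1 s - x.1 s)| ≤ D.κ := by
    rw [abs_mul, abs_of_nonneg (sq_nonneg _)]
    exact (mul_le_of_le_one_left (abs_nonneg _) h4).trans h3
  rw [abs_le] at h6
  linarith [h6.1]

lemma exists_curve (B : ℝ) : ∃ ε > 0, ε ≤ 1 / 2 ∧ ∀ a ∈ Ioo (-ε) 0,
    ∀ x₀ ∈ admissible (2 * D.κ) B, ∃ X : ℝ → ConeFun × ConeFun, X a = x₀ ∧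
      (∀ U, X U ∈ admissible D.κ (B + 1)) ∧
      ∀ U ∈ Ioo (2 * a) 0, HasDerivAt X (D.field U (X U)) U := by
  obtain ⟨L₁, hL₁, l₁⟩ := (D.tame_accel (B + 1)).bdd
  obtain ⟨L₂, hL₂, l₂⟩ := (D.tame_field_snd (B + 1)).bdd
  obtain ⟨K₁, hK₁, k₁⟩ := (D.tame_accel (B + 1)).lip
  obtain ⟨K₂, hK₂, k₂⟩ := (D.tame_field_snd (B + 1)).lip
  have hκ := D.κ_pos
  have hL : 0 < max L₁ L₂ + 1 := by positivity
  refine ⟨min (1 / 2) (D.κ / (max L₁ L₂ + 1)), by positivity, min_le_left _ _,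
    fun a ha x₀ hx₀ => ?_⟩
  have ha0 : a < 0 := ha.2
  have ha1 : -a ≤ 1 / 2 := by linarith [ha.1, min_le_left (1 / 2) (D.κ / (max L₁ L₂ + 1))]
  have ha2 : (max L₁ L₂ + 1) * (-a) ≤ D.κ := by
    rw [mul_comm, ← le_div_iff₀ hL]
    linarith [ha.1, min_le_right (1 / 2) (D.κ / (max L₁ L₂ + 1))]
  have hsub : ∀ t ∈ Icc (2 * a) 0, t ∈ Icc (-1 : ℝ) 0 := fun t ht => ⟨by linarith [ht.1], ht.2⟩
  have hball := D.closedBall_subset_admissible hx₀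
  have hP : IsPicardLindelof D.field (tmin := 2 * a) (tmax := 0)
      ⟨a, by linarith, by linarith⟩ x₀ ⟨D.κ, hκ.le⟩ 0 ⟨max L₁ L₂ + 1, hL.le⟩
      ⟨max K₁ K₂, le_max_of_le_left hK₁⟩ := by
    constructor
    · refine fun t ht => LipschitzOnWith.of_dist_le_mul fun x hx y hy => ?_
      rw [dist_eq_norm x, dist_eq_norm (D.field t x)]
      have h1 := k₁ t (hsub t ht) x (hball hx) y (hball hy)
      have h2 := k₂ t (hsub t ht) x (hball hx) y (hball hy)
      refine norm_prod_le_iff.2 ⟨h1.trans ?_, h2.trans ?_⟩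
      · exact mul_le_mul_of_nonneg_right (le_max_left _ _) (norm_nonneg _)
      · exact mul_le_mul_of_nonneg_right (le_max_right _ _) (norm_nonneg _)
    · exact fun x hx => (((D.tame_accel (B + 1)).cont x (hball hx)).mono hsub).prodMk
        (((D.tame_field_snd (B + 1)).cont x (hball hx)).mono hsub)
    · intro t ht x hx
      refine norm_prod_le_iff.2 ⟨(l₁ t (hsub t ht) x (hball hx)).trans ?_,
        (l₂ t (hsub t ht) x (hball hx)).trans ?_⟩
      · exact (le_max_left L₁ L₂).trans (le_add_of_nonneg_right zero_le_one)
      · exact (le_max_right L₁ L₂).trans (le_add_of_nonneg_right zero_le_one)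
    · have : max (0 - a) (a - 2 * a) = -a := by
        rw [max_eq_left] <;> linarith
      show (max L₁ L₂ + 1) * max (0 - a) (a - 2 * a) ≤ D.κ - (0 : NNReal)
      rw [this]
      simpa using ha2
  obtain ⟨X, hX, hmem, hd⟩ := hP.exists_curve_mem_closedBall
  exact ⟨X, hX, fun U => hball (hmem U), hd⟩

end IngoingData

namespace ConeFun

/-- The value of `x` at the point with coordinate `V`. -/
def value (x : ConeFun) (V : ℝ) : ℝ := x (clampI (1 - V⁻¹))

/-- The integral `∫₁^V x dV / V²`. -/
def primV (x : ConeFun) (V : ℝ) : ℝ := prim x (1 - V⁻¹)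

lemma coe_clampI {V : ℝ} (hV : 1 ≤ V) : (clampI (1 - V⁻¹) : ℝ) = 1 - V⁻¹ := by
  have h : (1 - V⁻¹) ∈ Icc (0 : ℝ) 1 :=
    ⟨sub_nonneg.2 (inv_le_one_of_one_le₀ hV), sub_le_self _ (by positivity)⟩
  simp [clampI, projIcc_of_mem zero_le_one h]

lemma hasDerivAt_primV (x : ConeFun) {V : ℝ} (hV : 0 < V) :
    HasDerivAt (primV x) (V⁻¹ ^ 2 * value x V) V := by
  have h : HasDerivAt (fun V : ℝ => 1 - V⁻¹) (V⁻¹ ^ 2) V :=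
    ((hasDerivAt_inv hV.ne').const_sub 1).congr_deriv (by simp)
  exact ((hasDerivAt_prim x _).comp V h).congr_deriv (mul_comm _ _)

lemma primV_one (x : ConeFun) : primV x 1 = 0 := by simp [primV, prim_zero]

lemma value_add (x y : ConeFun) (V : ℝ) : value (x + y) V = value x V + value y V := rfl
lemma value_sub (x y : ConeFun) (V : ℝ) : value (x - y) V = value x V - value y V := rfl
lemma value_mul (x y : ConeFun) (V : ℝ) : value (x * y) V = value x V * value y V := rfl
lemma value_pow (x : ConeFun) (n : ℕ) (V : ℝ) : value (x ^ n) V = value x V ^ n := rfl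
lemma value_smul (c : ℝ) (x : ConeFun) (V : ℝ) : value (c • x) V = c * value x V := rfl
lemma value_neg (x : ConeFun) (V : ℝ) : value (-x) V = -value x V := rfl
lemma value_one (V : ℝ) : value 1 V = 1 := rfl

lemma value_exp (x : ConeFun) (V : ℝ) :
    value (NormedSpace.exp x) V = Real.exp (value x V) := exp_apply _ _

lemma value_tau {V : ℝ} (hV : 1 ≤ V) : value tau V = V⁻¹ := by
  rw [value, tau_apply, coe_clampI hV]; ring

lemma value_primOp (x : ConeFun) {V : ℝ} (hV : 1 ≤ V) : value (primOp x) V = primV x V := by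
  rw [value, primOp_apply, coe_clampI hV, primV]

lemma value_inverse {κ : ℝ} (hκ : 0 < κ) {x : ConeFun} (h : ∀ s, κ ≤ x s) (V : ℝ) :
    value (Ring.inverse x) V = (value x V)⁻¹ := inverse_apply hκ h _

lemma abs_value_le (x : ConeFun) (V : ℝ) : |value x V| ≤ ‖x‖ := x.abs_apply_le _

end ConeFun

namespace IngoingData

variable (D : IngoingData)

/-- The Hawking mass. -/
def mass (U : ℝ) (x : ConeFun × ConeFun) : ConeFun :=
  D.wmass U x * NormedSpace.exp (-primOp (tau * D.beta U x))

/-- `V²` times the `V`-derivative of the Hawking mass. -/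
def massFlux (U : ℝ) (x : ConeFun × ConeFun) : ConeFun :=
  ((1 / 2 : ℝ) • D.rho U x - tau * D.mass U x) * D.beta U x

/-- The area radius as a function of `V`. -/
def radius (U : ℝ) (x : ConeFun × ConeFun) (V : ℝ) : ℝ := D.r U + (V - 1) / 2 + primV x.1 V

/-- `r φ` as a function of `V`. -/
def rphi (U : ℝ) (x : ConeFun × ConeFun) (V : ℝ) : ℝ := D.r U * D.φ U + primV x.2 V

/-- The Hawking mass as a function of `V`. -/
def hawking (U : ℝ) (x : ConeFun × ConeFun) (V : ℝ) : ℝ := D.m U + primV (D.massFlux U x) V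

/-- `∂_U r` as a function of `V`. -/
def nu (U : ℝ) (x : ConeFun × ConeFun) (V : ℝ) : ℝ := D.ν U + primV (D.accel U x) V

/-- `∂_V φ` as a function of `V`. -/
def phiV (U : ℝ) (x : ConeFun × ConeFun) (V : ℝ) : ℝ :=
  (V⁻¹ ^ 2 * value x.2 V - value (lam x) V * (D.rphi U x V / D.radius U x V)) / D.radius U x V

variable {D} {B U V : ℝ} {x : ConeFun × ConeFun}

lemma value_lam (hV : 1 ≤ V) : value (lam x) V = 1 / 2 + V⁻¹ ^ 2 * value x.1 V := by
  simp [lam, value_add, value_mul, value_smul, value_one, value_pow, value_tau hV]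

lemma value_rho (hV : 1 ≤ V) : value (D.rho U x) V = V⁻¹ * D.radius U x V := by
  have : V ≠ 0 := by positivity
  simp only [rho, value_add, value_sub, value_mul, value_smul, value_one, value_tau hV,
    value_primOp _ hV, radius]
  field_simp
  ring

lemma value_psi (hV : 1 ≤ V) : value (D.psi U x) V = D.rphi U x V := by
  simp only [psi, value_add, value_smul, value_one, value_primOp _ hV, rphi, mul_one]

section

variable (hU : U ∈ Icc (-1 : ℝ) 0) (hx : x ∈ admissible D.κ B)
include hU hx

omit hU in
lemma radius_sub_ge {c : ℝ} (hc : D.κ ≤ D.r U - c) (hV : 1 ≤ V) :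
    D.κ * V ≤ D.radius U x V - c := by
  have h := rho_sub_ge (lam_ge hx) D.κ_le hc (ConeFun.clampI (1 - V⁻¹))
  have h0 : 0 < V := by positivity
  have e := value_rho (D := D) (U := U) (x := x) hV
  rw [value] at e
  rw [e, ConeFun.coe_clampI hV] at h
  have := mul_le_mul_of_nonneg_right h h0.le
  have e2 : (V⁻¹ * D.radius U x V - (1 - (1 - V⁻¹)) * c) * V = D.radius U x V - c := by
    field_simp; ring
  rwa [e2] at this

lemma radius_ge (hV : 1 ≤ V) : D.κ * V ≤ D.radius U x V := by
  simpa using radius_sub_ge hx (c := 0) (by simpa using D.r_ge U hU) hV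

lemma radius_pos (hV : 1 ≤ V) : 0 < D.radius U x V :=
  (mul_pos D.κ_pos (by positivity)).trans_le (radius_ge hU hx hV)

omit hU in
lemma value_lam_pos : 0 < value (lam x) V := D.κ_pos.trans_le (lam_ge hx _)

lemma value_inverse_rho (hV : 1 ≤ V) :
    value (Ring.inverse (D.rho U x)) V = V / D.radius U x V := by
  rw [value_inverse D.κ_pos (rho_ge hU hx), value_rho hV, mul_inv, inv_inv, div_eq_mul_inv]

omit hU in
lemma value_inverse_lam : value (Ring.inverse (lam x)) V = (value (lam x) V)⁻¹ :=
  value_inverse D.κ_pos (lam_ge hx) V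

lemma value_tee (hV : 1 ≤ V) :
    value (D.tee U x) V = V * D.radius U x V * D.phiV U x V := by
  have h0 : V ≠ 0 := by positivity
  have h1 := (radius_pos hU hx hV).ne'
  simp only [tee, value_sub, value_mul, value_tau hV, value_psi hV, value_inverse_rho hU hx hV,
    phiV]
  field_simp

lemma value_beta (hV : 1 ≤ V) : value (D.beta U x) V =
    V ^ 3 * D.radius U x V * D.phiV U x V ^ 2 / value (lam x) V := by
  have h1 := (radius_pos hU hx hV).ne'
  simp only [beta, value_mul, value_pow, value_tee hU hx hV, value_inverse_rho hU hx hV,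
    value_inverse_lam hx]
  field_simp

end

end IngoingData

lemma le_of_hasDerivAt_nonneg_Ici {f f' : ℝ → ℝ} {a b : ℝ}
    (hf : ∀ x, a ≤ x → HasDerivAt f (f' x) x) (h0 : ∀ x, a ≤ x → 0 ≤ f' x) (hab : a ≤ b) :
    f a ≤ f b := by
  refine monotoneOn_of_deriv_nonneg (convex_Ici a)
    (fun x hx => (hf x hx).continuousAt.continuousWithinAt)
    (fun x hx => (hf x (interior_subset hx)).differentiableAt.differentiableWithinAt)
    (fun x hx => ?_) self_mem_Ici hab hab
  rw [(hf x (interior_subset hx)).deriv]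
  exact h0 x (interior_subset hx)

lemma eq_of_hasDerivAt_eq_Ici {f g f' : ℝ → ℝ} {a b : ℝ}
    (hf : ∀ x, a ≤ x → HasDerivAt f (f' x) x) (hg : ∀ x, a ≤ x → HasDerivAt g (f' x) x)
    (h : f a = g a) (hab : a ≤ b) : f b = g b := by
  have h1 := le_of_hasDerivAt_nonneg_Ici (f := fun x => f x - g x) (f' := fun _ => 0)
    (fun x hx => ((hf x hx).sub (hg x hx)).congr_deriv (sub_self _)) (fun _ _ => le_rfl) hab
  have h2 := le_of_hasDerivAt_nonneg_Ici (f := fun x => g x - f x) (f' := fun _ => 0)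
    (fun x hx => ((hg x hx).sub (hf x hx)).congr_deriv (sub_self _)) (fun _ _ => le_rfl) hab
  linarith

namespace IngoingData

variable (D : IngoingData)

/-- The integrating factor as a function of `V`. -/
def factor (U : ℝ) (x : ConeFun × ConeFun) (V : ℝ) : ℝ := Real.exp (primV (tau * D.beta U x) V)

/-- `∂_U ∂_V r` as a function of `V`. -/
def mixed (U : ℝ) (x : ConeFun × ConeFun) (V : ℝ) : ℝ :=
  2 * D.hawking U x V * value (lam x) V * D.nu U x V /
    (D.radius U x V * (D.radius U x V - 2 * D.hawking U x V))

/-- The weighted mass as a function of `V`. -/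
def wmassV (U : ℝ) (x : ConeFun × ConeFun) (V : ℝ) : ℝ :=
  D.m U + 1 / 2 * primV (D.gam U x * D.tee U x ^ 2 * Ring.inverse (lam x)) V

variable {D} {B U V : ℝ} {x : ConeFun × ConeFun}

lemma value_gam (hV : 1 ≤ V) : value (D.gam U x) V = D.factor U x V := by
  rw [gam, value_exp, value_primOp _ hV, factor]

lemma value_wmass (hV : 1 ≤ V) : value (D.wmass U x) V = D.wmassV U x V := by
  simp only [wmass, value_add, value_smul, value_one, value_primOp _ hV, wmassV, mul_one]

lemma factor_pos : 0 < D.factor U x V := Real.exp_pos _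

lemma value_mass (hV : 1 ≤ V) :
    value (D.mass U x) V = D.wmassV U x V / D.factor U x V := by
  rw [mass, value_mul, value_exp, value_neg, value_primOp _ hV, Real.exp_neg, value_wmass hV,
    factor, div_eq_mul_inv]

lemma hasDerivAt_radius (hV : 1 ≤ V) :
    HasDerivAt (D.radius U x) (value (lam x) V) V := by
  refine (((((hasDerivAt_id V).sub_const 1).div_const 2).const_add (D.r U)).add
    (hasDerivAt_primV x.1 (by positivity))).congr_deriv ?_
  rw [value_lam hV]

lemma hasDerivAt_rphi (hV : 0 < V) :
    HasDerivAt (D.rphi U x) (V⁻¹ ^ 2 * value x.2 V) V :=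
  (hasDerivAt_primV x.2 hV).const_add _

section

variable (hU : U ∈ Icc (-1 : ℝ) 0) (hx : x ∈ admissible D.κ B)
include hU hx

lemma hasDerivAt_rphi_div_radius (hV : 1 ≤ V) :
    HasDerivAt (fun V => D.rphi U x V / D.radius U x V) (D.phiV U x V) V := by
  have h := (radius_pos hU hx hV).ne'
  refine ((hasDerivAt_rphi (by positivity)).div (hasDerivAt_radius hV) h).congr_deriv ?_
  rw [phiV]
  field_simp

lemma value_accel (hV : 1 ≤ V) : value (D.accel U x) V =
    V ^ 2 * (2 * D.γ U * value (lam x) V * D.wmassV U x V / D.radius U x V ^ 2) := by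
  simp only [accel, value_smul, value_mul, value_pow, value_wmass hV, value_inverse_rho hU hx hV]
  ring

lemma value_massFlux (hV : 1 ≤ V) : value (D.massFlux U x) V =
    V ^ 2 * ((D.radius U x V - 2 * (D.wmassV U x V / D.factor U x V)) * D.radius U x V *
      D.phiV U x V ^ 2 / (2 * value (lam x) V)) := by
  have h : V ≠ 0 := by positivity
  have h1 := (value_lam_pos hx (V := V)).ne'
  simp only [massFlux, value_sub, value_smul, value_mul, value_mass hV, value_rho hV,
    value_tau hV, value_beta hU hx hV]
  field_simp

lemma hasDerivAt_factor (hV : 1 ≤ V) : HasDerivAt (D.factor U x)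
    (D.factor U x V * (D.radius U x V * D.phiV U x V ^ 2 / value (lam x) V)) V := by
  have h : V ≠ 0 := by positivity
  have h1 := (value_lam_pos hx (V := V)).ne'
  refine (hasDerivAt_primV (tau * D.beta U x) (by positivity)).exp.congr_deriv ?_
  rw [value_mul, value_tau hV, value_beta hU hx hV, factor]
  field_simp

lemma hasDerivAt_wmassV (hV : 1 ≤ V) : HasDerivAt (D.wmassV U x)
    (D.factor U x V * (D.radius U x V ^ 2 * D.phiV U x V ^ 2 / (2 * value (lam x) V))) V := by
  have h : V ≠ 0 := by positivity
  have h1 := (value_lam_pos hx (V := V)).ne'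
  refine (((hasDerivAt_primV (D.gam U x * D.tee U x ^ 2 * Ring.inverse (lam x))
    (by positivity)).const_mul (1 / 2)).const_add (D.m U)).congr_deriv ?_
  rw [value_mul, value_mul, value_pow, value_gam hV, value_tee hU hx hV, value_inverse_lam hx]
  field_simp

lemma hasDerivAt_nu (hV : 1 ≤ V) : HasDerivAt (D.nu U x)
    (2 * D.γ U * value (lam x) V * D.wmassV U x V / D.radius U x V ^ 2) V := by
  have h : V ≠ 0 := by positivity
  refine ((hasDerivAt_primV (D.accel U x) (by positivity)).const_add (D.ν U)).congr_deriv ?_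
  rw [value_accel hU hx hV]
  field_simp

lemma nu_eq (hV : 1 ≤ V) : D.nu U x V =
    D.γ U * (D.factor U x V - 2 * D.wmassV U x V / D.radius U x V) := by
  refine eq_of_hasDerivAt_eq_Ici
    (g := fun V => D.γ U * (D.factor U x V - 2 * D.wmassV U x V / D.radius U x V))
    (fun V hV => hasDerivAt_nu hU hx hV)
    (fun V hV => (((hasDerivAt_factor hU hx hV).sub (((hasDerivAt_wmassV hU hx hV).const_mul 2).div
      (hasDerivAt_radius hV) (radius_pos hU hx hV).ne')).const_mul (D.γ U)).congr_deriv ?_) ?_ hV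
  · have h := (radius_pos hU hx hV).ne'
    have h1 := (value_lam_pos hx (V := V)).ne'
    field_simp
    ring
  · have h1 := (D.κ_pos.trans_le (D.r_ge U hU)).ne'
    have h2 := (D.κ_pos.trans_le (D.gap U hU)).ne'
    simp only [nu, primV_one, factor, wmassV, radius, γ]
    simp
    field_simp

lemma hasDerivAt_hawking_aux (hV : 1 ≤ V) : HasDerivAt (D.hawking U x)
    ((D.radius U x V - 2 * (D.wmassV U x V / D.factor U x V)) * D.radius U x V *
      D.phiV U x V ^ 2 / (2 * value (lam x) V)) V := by
  have h : V ≠ 0 := by positivity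
  refine ((hasDerivAt_primV (D.massFlux U x) (by positivity)).const_add (D.m U)).congr_deriv ?_
  rw [value_massFlux hU hx hV]
  field_simp

lemma hawking_eq (hV : 1 ≤ V) : D.hawking U x V = D.wmassV U x V / D.factor U x V := by
  refine eq_of_hasDerivAt_eq_Ici (g := fun V => D.wmassV U x V / D.factor U x V)
    (fun V hV => hasDerivAt_hawking_aux hU hx hV)
    (fun V hV => ((hasDerivAt_wmassV hU hx hV).div (hasDerivAt_factor hU hx hV)
      factor_pos.ne').congr_deriv ?_) ?_ hV
  · have h := (factor_pos (D := D) (U := U) (x := x) (V := V)).ne'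
    have h1 := (value_lam_pos hx (V := V)).ne'
    field_simp
  · simp [hawking, wmassV, factor, primV_one]

lemma hasDerivAt_hawking (hV : 1 ≤ V) : HasDerivAt (D.hawking U x)
    ((D.radius U x V - 2 * D.hawking U x V) * D.radius U x V *
      D.phiV U x V ^ 2 / (2 * value (lam x) V)) V := by
  rw [hawking_eq hU hx hV]
  exact hasDerivAt_hawking_aux hU hx hV

lemma one_le_factor (hV : 1 ≤ V) : 1 ≤ D.factor U x V := by
  have := le_of_hasDerivAt_nonneg_Ici (f := D.factor U x)
    (fun V hV => hasDerivAt_factor hU hx hV) (fun V hV => by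
      have h := radius_pos hU hx hV
      have h1 := value_lam_pos hx (V := V)
      have h2 := factor_pos (D := D) (U := U) (x := x) (V := V)
      positivity) hV
  simpa [factor, primV_one] using this

lemma m_le_wmassV (hV : 1 ≤ V) : D.m U ≤ D.wmassV U x V := by
  have := le_of_hasDerivAt_nonneg_Ici (f := D.wmassV U x)
    (fun V hV => hasDerivAt_wmassV hU hx hV) (fun V hV => by
      have h1 := value_lam_pos hx (V := V)
      have h2 := factor_pos (D := D) (U := U) (x := x) (V := V)
      positivity) hV
  simpa [wmassV, primV_one] using this

lemma hawking_nonneg (hV : 1 ≤ V) : 0 ≤ D.hawking U x V := by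
  rw [hawking_eq hU hx hV]
  exact div_nonneg ((D.m_nonneg U hU).trans (m_le_wmassV hU hx hV)) factor_pos.le

lemma factor_mul_gap_ge (hV : 1 ≤ V) :
    D.κ * V ≤ D.factor U x V * (D.radius U x V - 2 * D.hawking U x V) := by
  have := le_of_hasDerivAt_nonneg_Ici
    (f := fun V => D.factor U x V * D.radius U x V - 2 * D.wmassV U x V - D.radius U x V)
    (fun V hV => (((hasDerivAt_factor hU hx hV).mul (hasDerivAt_radius hV)).sub
      ((hasDerivAt_wmassV hU hx hV).const_mul 2)).sub (hasDerivAt_radius hV)) (fun V hV => by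
      have h1 := value_lam_pos hx (V := V)
      have h2 := one_le_factor hU hx hV
      have h3 : 0 ≤ (D.factor U x V - 1) * value (lam x) V :=
        mul_nonneg (sub_nonneg.2 h2) h1.le
      refine h3.trans (le_of_eq ?_)
      have := h1.ne'
      field_simp
      ring) hV
  have h1 := radius_sub_ge hx (c := 2 * D.m U) (D.gap U hU) hV
  simp only [factor, wmassV, primV_one, radius] at this
  norm_num at this
  have h4 : D.factor U x V * (D.radius U x V - 2 * D.hawking U x V) =
      D.factor U x V * D.radius U x V - 2 * D.wmassV U x V := by
    rw [hawking_eq hU hx hV]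
    have := (factor_pos (D := D) (U := U) (x := x) (V := V)).ne'
    field_simp
  rw [h4]
  simp only [factor, wmassV, radius] at h1 ⊢
  norm_num at h1 ⊢
  linarith

lemma gap_pos (hV : 1 ≤ V) : 0 < D.radius U x V - 2 * D.hawking U x V := by
  have h := (mul_pos D.κ_pos (zero_lt_one.trans_le hV)).trans_le (factor_mul_gap_ge hU hx hV)
  exact pos_of_mul_pos_right h factor_pos.le

lemma nu_eq_gap (hV : 1 ≤ V) : D.nu U x V = D.γ U *
    (D.factor U x V * (D.radius U x V - 2 * D.hawking U x V) / D.radius U x V) := by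
  have h := (radius_pos hU hx hV).ne'
  have h1 := (factor_pos (D := D) (U := U) (x := x) (V := V)).ne'
  rw [nu_eq hU hx hV, hawking_eq hU hx hV]
  field_simp

omit hx in
lemma γ_neg : D.γ U < 0 := by
  have h1 := D.κ_pos.trans_le (D.r_ge U hU)
  have h2 := D.κ_pos.trans_le (D.gap U hU)
  have h3 := D.κ_pos.trans_le (D.ν_le U hU)
  exact div_neg_of_neg_of_pos (mul_neg_of_neg_of_pos (by linarith) h1) h2

lemma nu_neg (hV : 1 ≤ V) : D.nu U x V < 0 := by
  rw [nu_eq_gap hU hx hV]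
  exact mul_neg_of_neg_of_pos (γ_neg hU) (div_pos (mul_pos factor_pos (gap_pos hU hx hV))
    (radius_pos hU hx hV))

lemma value_accel_eq_mixed (hV : 1 ≤ V) : V⁻¹ ^ 2 * value (D.accel U x) V = D.mixed U x V := by
  have h := (radius_pos hU hx hV).ne'
  have h1 := (factor_pos (D := D) (U := U) (x := x) (V := V)).ne'
  have h2 := (gap_pos hU hx hV).ne'
  have h3 : V ≠ 0 := by positivity
  rw [mixed, value_accel hU hx hV, nu_eq_gap hU hx hV,
    show D.wmassV U x V = D.hawking U x V * D.factor U x V by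
      rw [hawking_eq hU hx hV]; field_simp]
  field_simp

lemma hasDerivAt_nu_mixed (hV : 1 ≤ V) : HasDerivAt (D.nu U x) (D.mixed U x V) V := by
  rw [← value_accel_eq_mixed hU hx hV]
  exact (hasDerivAt_primV (D.accel U x) (by positivity)).const_add (D.ν U)

end
end IngoingData

namespace IngoingData

/-- A solution of the evolution equation in `U`, on `(a, 0)`. -/
structure IsEvolution (D : IngoingData) (B a : ℝ) (X : ℝ → ConeFun × ConeFun) : Prop where
  lower : -1 ≤ a
  mem : ∀ U, X U ∈ admissible D.κ B
  deriv : ∀ U ∈ Ioo a 0, HasDerivAt X (D.field U (X U)) U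

variable {D : IngoingData} {B a U V : ℝ} {X : ℝ → ConeFun × ConeFun}

lemma contDiffOn_one_of_hasDerivAt {E : Type*} [NormedAddCommGroup E] [NormedSpace ℝ E]
    {f f' : ℝ → E} {s : Set ℝ} (hs : IsOpen s) (hf : ∀ t ∈ s, HasDerivAt f (f' t) t)
    (hf' : ContinuousOn f' s) : ContDiffOn ℝ 1 f s := by
  rw [show (1 : WithTop ℕ∞) = 0 + 1 from rfl, contDiffOn_succ_iff_deriv_of_isOpen hs]
  refine ⟨fun t ht => (hf t ht).differentiableAt.differentiableWithinAt, by simp, ?_⟩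
  rw [contDiffOn_zero]
  exact hf'.congr fun t ht => (hf t ht).deriv

lemma _root_.ContDiffOn.coneFun_inverse {κ : ℝ} (hκ : 0 < κ) {f : ℝ → ConeFun} {s : Set ℝ}
    (hf : ContDiffOn ℝ 1 f s) (h : ∀ t ∈ s, ∀ i, κ ≤ f t i) :
    ContDiffOn ℝ 1 (fun t => Ring.inverse (f t)) s := fun t ht => by
  obtain ⟨u, hu⟩ := isUnit_of_le hκ (h t ht)
  have := contDiffAt_ringInverse (n := 1) ℝ u
  rw [hu] at this
  exact this.comp_contDiffWithinAt t (hf t ht)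

namespace IsEvolution

variable (h : D.IsEvolution B a X)
include h

lemma Ioo_subset : Ioo a 0 ⊆ Icc (-1) 0 := fun _ hU => ⟨h.lower.trans hU.1.le, hU.2.le⟩

lemma Ioo_subset_Ioo : Ioo a 0 ⊆ Ioo (-1) 0 := fun _ hU => ⟨h.lower.trans_lt hU.1, hU.2⟩

lemma contDiffOn : ContDiffOn ℝ 1 X (Ioo a 0) := by
  have hc : ContinuousOn X (Ioo a 0) := fun U hU => (h.deriv U hU).continuousAt.continuousWithinAt
  exact contDiffOn_one_of_hasDerivAt isOpen_Ioo h.deriv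
    (((D.tame_accel B).continuousOn_curve h.Ioo_subset hc fun U _ => h.mem U).prodMk
      ((D.tame_field_snd B).continuousOn_curve h.Ioo_subset hc fun U _ => h.mem U))

lemma contDiffOn_r : ContDiffOn ℝ 1 D.r (Ioo a 0) :=
  contDiffOn_one_of_hasDerivAt isOpen_Ioo (fun U hU => D.deriv_r U (h.Ioo_subset_Ioo hU))
    D.cont_ν.continuousOn

lemma contDiffOn_φ : ContDiffOn ℝ 1 D.φ (Ioo a 0) :=
  contDiffOn_one_of_hasDerivAt isOpen_Ioo (fun U hU => D.deriv_φ U (h.Ioo_subset_Ioo hU))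
    (D.cont_b.mono h.Ioo_subset_Ioo)

lemma contDiffOn_m : ContDiffOn ℝ 1 D.m (Ioo a 0) := by
  refine contDiffOn_one_of_hasDerivAt isOpen_Ioo (fun U hU => D.deriv_m U (h.Ioo_subset_Ioo hU)) ?_
  have := D.cont_b.mono h.Ioo_subset_Ioo
  have := D.cont_r
  have := D.cont_m
  have := D.cont_ν
  refine ContinuousOn.div (by fun_prop) (by fun_prop) fun U hU => ?_
  have := D.ν_le U (h.Ioo_subset hU)
  have := D.κ_pos
  intro h0
  linarith

lemma contDiffOn_rho : ContDiffOn ℝ 1 (fun U => D.rho U (X U)) (Ioo a 0) := by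
  have := h.contDiffOn
  have := h.contDiffOn_r
  exact (contDiffOn_const.mul ((this.smul contDiffOn_const).add
    (primOp.contDiff.comp_contDiffOn h.contDiffOn.fst))).add contDiffOn_const

lemma contDiffOn_lam : ContDiffOn ℝ 1 (fun U => lam (X U)) (Ioo a 0) :=
  contDiffOn_const.add (contDiffOn_const.mul h.contDiffOn.fst)

lemma contDiffOn_inverse_rho :
    ContDiffOn ℝ 1 (fun U => Ring.inverse (D.rho U (X U))) (Ioo a 0) :=
  h.contDiffOn_rho.coneFun_inverse D.κ_pos fun U hU => rho_ge (h.Ioo_subset hU) (h.mem U)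

lemma contDiffOn_inverse_lam :
    ContDiffOn ℝ 1 (fun U => Ring.inverse (lam (X U))) (Ioo a 0) :=
  h.contDiffOn_lam.coneFun_inverse D.κ_pos fun U _ => lam_ge (h.mem U)

lemma contDiffOn_psi : ContDiffOn ℝ 1 (fun U => D.psi U (X U)) (Ioo a 0) :=
  ((h.contDiffOn_r.mul h.contDiffOn_φ).smul contDiffOn_const).add
    (primOp.contDiff.comp_contDiffOn h.contDiffOn.snd)

lemma contDiffOn_tee : ContDiffOn ℝ 1 (fun U => D.tee U (X U)) (Ioo a 0) :=
  (contDiffOn_const.mul h.contDiffOn.snd).sub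
    ((h.contDiffOn_lam.mul h.contDiffOn_psi).mul h.contDiffOn_inverse_rho)

lemma contDiffOn_beta : ContDiffOn ℝ 1 (fun U => D.beta U (X U)) (Ioo a 0) :=
  ((h.contDiffOn_tee.pow 2).mul h.contDiffOn_inverse_rho).mul h.contDiffOn_inverse_lam

lemma contDiffOn_primOp_beta :
    ContDiffOn ℝ 1 (fun U => primOp (tau * D.beta U (X U))) (Ioo a 0) :=
  primOp.contDiff.comp_contDiffOn (contDiffOn_const.mul h.contDiffOn_beta)

lemma contDiffOn_gam : ContDiffOn ℝ 1 (fun U => D.gam U (X U)) (Ioo a 0) :=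
  contDiff_exp.comp_contDiffOn h.contDiffOn_primOp_beta

lemma contDiffOn_wmass : ContDiffOn ℝ 1 (fun U => D.wmass U (X U)) (Ioo a 0) := by
  have h1 : ContDiffOn ℝ 1 (fun U => primOp (D.gam U (X U) * D.tee U (X U) ^ 2 *
      Ring.inverse (lam (X U)))) (Ioo a 0) :=
    primOp.contDiff.comp_contDiffOn ((h.contDiffOn_gam.mul (h.contDiffOn_tee.pow 2)).mul
      h.contDiffOn_inverse_lam)
  exact (h.contDiffOn_m.smul contDiffOn_const).add (h1.const_smul (1 / 2 : ℝ))

lemma contDiffOn_mass : ContDiffOn ℝ 1 (fun U => D.mass U (X U)) (Ioo a 0) := by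
  have h1 : ContDiffOn ℝ 1 (fun U => NormedSpace.exp (-primOp (tau * D.beta U (X U))))
    (Ioo a 0) := contDiff_exp.comp_contDiffOn h.contDiffOn_primOp_beta.neg
  exact h.contDiffOn_wmass.mul h1

lemma contDiffOn_massFlux : ContDiffOn ℝ 1 (fun U => D.massFlux U (X U)) (Ioo a 0) := by
  have h1 := h.contDiffOn_rho.const_smul (1 / 2 : ℝ)
  have h2 : ContDiffOn ℝ 1 (fun U => tau * D.mass U (X U)) (Ioo a 0) :=
    contDiffOn_const.mul h.contDiffOn_mass
  exact (h1.sub h2).mul h.contDiffOn_beta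

end IsEvolution
end IngoingData

lemma HasDerivAt.value {f : ℝ → ConeFun} {f' : ConeFun} {t : ℝ} (h : HasDerivAt f f' t) (V : ℝ) :
    HasDerivAt (fun t => value (f t) V) (ConeFun.value f' V) t :=
  (evalL (1 - V⁻¹)).hasFDerivAt.comp_hasDerivAt t h

lemma HasDerivAt.primV {f : ℝ → ConeFun} {f' : ConeFun} {t : ℝ} (h : HasDerivAt f f' t) (V : ℝ) :
    HasDerivAt (fun t => primV (f t) V) (ConeFun.primV f' V) t :=
  (primL (1 - V⁻¹)).hasFDerivAt.comp_hasDerivAt t h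

namespace IngoingData

/-- `∂_U (r φ)` as a function of `V`. -/
def rphiU (D : IngoingData) (U : ℝ) (x : ConeFun × ConeFun) (V : ℝ) : ℝ :=
  D.ν U * D.φ U + D.r U * D.b U + primV (D.field U x).2 V

/-- `∂_U φ` as a function of `V`. -/
def phiU (D : IngoingData) (U : ℝ) (x : ConeFun × ConeFun) (V : ℝ) : ℝ :=
  (D.rphiU U x V - D.rphi U x V / D.radius U x V * D.nu U x V) / D.radius U x V

/-- The `U`-derivative of the Hawking mass along a curve, as a function of `V`. -/
def hawkingU (D : IngoingData) (X : ℝ → ConeFun × ConeFun) (U V : ℝ) : ℝ :=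
  (D.r U - 2 * D.m U) * D.r U * D.b U ^ 2 / (2 * D.ν U) +
    primV (deriv (fun U => D.massFlux U (X U)) U) V

variable {D : IngoingData} {B a U V : ℝ} {x : ConeFun × ConeFun} {X : ℝ → ConeFun × ConeFun}

lemma value_field_snd (hU : U ∈ Icc (-1 : ℝ) 0) (hx : x ∈ admissible D.κ B) (hV : 1 ≤ V) :
    V⁻¹ ^ 2 * value (D.field U x).2 V = D.rphi U x V / D.radius U x V * D.mixed U x V := by
  have h1 := (radius_pos hU hx hV).ne'
  have h3 : V ≠ 0 := by positivity
  rw [← value_accel_eq_mixed hU hx hV, field]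
  simp only [value_mul, value_tau hV, value_psi hV, value_inverse_rho hU hx hV]
  field_simp

lemma hasDerivAt_rphiU (hU : U ∈ Icc (-1 : ℝ) 0) (hx : x ∈ admissible D.κ B) (hV : 1 ≤ V) :
    HasDerivAt (D.rphiU U x) (D.rphi U x V / D.radius U x V * D.mixed U x V) V := by
  rw [← value_field_snd hU hx hV]
  exact (hasDerivAt_primV _ (by positivity)).const_add _

/-- The wave equation for the scalar field, in the form of a formula for `∂_V ∂_U φ`. -/
lemma hasDerivAt_phiU (hU : U ∈ Icc (-1 : ℝ) 0) (hx : x ∈ admissible D.κ B) (hV : 1 ≤ V) :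
    HasDerivAt (D.phiU U x) ((-value (lam x) V * D.phiU U x V - D.nu U x V * D.phiV U x V) /
      D.radius U x V) V := by
  have h1 := (radius_pos hU hx hV).ne'
  refine (((hasDerivAt_rphiU hU hx hV).sub ((hasDerivAt_rphi_div_radius hU hx hV).mul
    (hasDerivAt_nu_mixed hU hx hV))).div (hasDerivAt_radius hV) h1).congr_deriv ?_
  simp only [phiU, Pi.sub_apply, Pi.mul_apply]
  field_simp
  ring

namespace IsEvolution

variable (h : D.IsEvolution B a X) (hU : U ∈ Ioo a 0)
include h hU

lemma deriv_fst : HasDerivAt (fun U => (X U).1) (D.accel U (X U)) U :=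
  (ContinuousLinearMap.fst ℝ ConeFun ConeFun).hasFDerivAt.comp_hasDerivAt U (h.deriv U hU)

lemma deriv_snd : HasDerivAt (fun U => (X U).2) (D.field U (X U)).2 U :=
  (ContinuousLinearMap.snd ℝ ConeFun ConeFun).hasFDerivAt.comp_hasDerivAt U (h.deriv U hU)

lemma hasDerivAt_radius : HasDerivAt (fun U => D.radius U (X U) V) (D.nu U (X U) V) U :=
  ((D.deriv_r U (h.Ioo_subset_Ioo hU)).add_const _).add ((h.deriv_fst hU).primV V)

lemma hasDerivAt_rphi : HasDerivAt (fun U => D.rphi U (X U) V) (D.rphiU U (X U) V) U :=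
  ((D.deriv_r U (h.Ioo_subset_Ioo hU)).mul (D.deriv_φ U (h.Ioo_subset_Ioo hU))).add
    ((h.deriv_snd hU).primV V)

lemma hasDerivAt_hawking : HasDerivAt (fun U => D.hawking U (X U) V) (D.hawkingU X U V) U := by
  have hd := (h.contDiffOn_massFlux.differentiableOn one_ne_zero).differentiableAt
    (Ioo_mem_nhds hU.1 hU.2)
  exact (D.deriv_m U (h.Ioo_subset_Ioo hU)).add (hd.hasDerivAt.primV V)

lemma hasDerivAt_rphi_div_radius (hV : 1 ≤ V) :
    HasDerivAt (fun U => D.rphi U (X U) V / D.radius U (X U) V) (D.phiU U (X U) V) U := by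
  have h1 := (radius_pos (h.Ioo_subset hU) (h.mem U) hV).ne'
  refine ((h.hasDerivAt_rphi hU).div (h.hasDerivAt_radius hU) h1).congr_deriv ?_
  rw [phiU]
  field_simp

lemma hasDerivAt_lam (hV : 1 ≤ V) :
    HasDerivAt (fun U => ConeFun.value (lam (X U)) V) (D.mixed U (X U) V) U := by
  simp only [value_lam hV]
  refine ((((h.deriv_fst hU).value V).const_mul (V⁻¹ ^ 2)).const_add (1 / 2)).congr_deriv ?_
  exact value_accel_eq_mixed (h.Ioo_subset hU) (h.mem U) hV

lemma hasDerivAt_phiV (hV : 1 ≤ V) : HasDerivAt (fun U => D.phiV U (X U) V)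
    ((-value (lam (X U)) V * D.phiU U (X U) V - D.nu U (X U) V * D.phiV U (X U) V) /
      D.radius U (X U) V) U := by
  have h1 := (radius_pos (h.Ioo_subset hU) (h.mem U) hV).ne'
  have hz := (((h.deriv_snd hU).value V).const_mul (V⁻¹ ^ 2)).congr_deriv
    (value_field_snd (h.Ioo_subset hU) (h.mem U) hV)
  refine ((hz.sub ((h.hasDerivAt_lam hU hV).mul (h.hasDerivAt_rphi_div_radius hU hV))).div
    (h.hasDerivAt_radius hU) h1).congr_deriv ?_
  simp only [phiV, Pi.sub_apply, Pi.mul_apply]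
  field_simp
  ring

/-- The constraint `2 ∂_U r ∂_U m = r² (1 - μ) (∂_U φ)²` propagates from `{V = 1}`. -/
lemma hawkingU_eq (hV : 1 ≤ V) : D.hawkingU X U V =
    (D.radius U (X U) V - 2 * D.hawking U (X U) V) * D.radius U (X U) V * D.phiU U (X U) V ^ 2 /
      (2 * D.nu U (X U) V) := by
  have hU' := h.Ioo_subset hU
  have hx := h.mem U
  set E : ℝ → ℝ := fun V => D.hawkingU X U V -
    (D.radius U (X U) V - 2 * D.hawking U (X U) V) * D.radius U (X U) V * D.phiU U (X U) V ^ 2 /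
      (2 * D.nu U (X U) V) with hE
  have hd : ∀ V, 1 ≤ V → HasDerivAt E
      (-(D.radius U (X U) V * D.phiV U (X U) V ^ 2 / value (lam (X U)) V) * E V) V := by
    intro V hV
    have n1 := (radius_pos hU' hx hV).ne'
    have n2 := (gap_pos hU' hx hV).ne'
    have n3 := (nu_neg hU' hx hV).ne
    have n4 := (value_lam_pos hx (V := V)).ne'
    have n5 : V ≠ 0 := by positivity
    have hm : HasDerivAt (D.hawkingU X U)
        (V⁻¹ ^ 2 * value (_root_.deriv (fun U => D.massFlux U (X U)) U) V) V :=
      (hasDerivAt_primV _ (by positivity)).const_add _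
    have hflux : V⁻¹ ^ 2 * value (_root_.deriv (fun U => D.massFlux U (X U)) U) V =
        (((D.nu U (X U) V - 2 * D.hawkingU X U V) * D.radius U (X U) V * D.phiV U (X U) V ^ 2 +
          (D.radius U (X U) V - 2 * D.hawking U (X U) V) * D.nu U (X U) V *
            D.phiV U (X U) V ^ 2 +
          (D.radius U (X U) V - 2 * D.hawking U (X U) V) * D.radius U (X U) V *
            (2 * D.phiV U (X U) V * ((-value (lam (X U)) V * D.phiU U (X U) V -
              D.nu U (X U) V * D.phiV U (X U) V) / D.radius U (X U) V))) *
            (2 * value (lam (X U)) V) -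
          (D.radius U (X U) V - 2 * D.hawking U (X U) V) * D.radius U (X U) V *
            D.phiV U (X U) V ^ 2 * (2 * D.mixed U (X U) V)) / (2 * value (lam (X U)) V) ^ 2 := by
      have hdf := ((h.contDiffOn_massFlux.differentiableOn one_ne_zero).differentiableAt
        (Ioo_mem_nhds hU.1 hU.2)).hasDerivAt
      refine ((hdf.value V).const_mul (V⁻¹ ^ 2)).unique ?_
      have hr := h.hasDerivAt_radius hU (V := V)
      have := ((((hr.sub ((h.hasDerivAt_hawking hU (V := V)).const_mul 2)).mul hr).mul
        ((h.hasDerivAt_phiV hU hV).pow 2)).div ((h.hasDerivAt_lam hU hV).const_mul 2)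
        (mul_ne_zero two_ne_zero n4))
      refine (this.congr_of_eventuallyEq ?_).congr_deriv ?_
      · filter_upwards [Ioo_mem_nhds hU.1 hU.2] with t ht
        have e := value_massFlux (h.Ioo_subset ht) (h.mem t) hV
        rw [e, ← hawking_eq (h.Ioo_subset ht) (h.mem t) hV]
        simp only [Pi.div_apply, Pi.mul_apply, Pi.sub_apply, Pi.pow_apply]
        field_simp
      · simp only [Pi.mul_apply, Pi.sub_apply, Pi.pow_apply]
        push_cast
        ring
    have hr := IngoingData.hasDerivAt_radius (D := D) (U := U) (x := X U) hV
    have hfin := hm.sub (((((hr.sub ((IngoingData.hasDerivAt_hawking hU' hx hV).const_mul 2)).mul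
      hr).mul ((hasDerivAt_phiU hU' hx hV).pow 2)).div
        ((hasDerivAt_nu_mixed hU' hx hV).const_mul 2) (mul_ne_zero two_ne_zero n3)))
    refine hfin.congr_deriv ?_
    rw [hflux, hE]
    simp only [mixed, Pi.mul_apply, Pi.sub_apply, Pi.pow_apply]
    push_cast
    field_simp
    ring
  have hE1 : E 1 = 0 := by
    have h1 := (D.κ_pos.trans_le (D.r_ge U hU')).ne'
    have h3 : D.ν U ≠ 0 := by have := D.ν_le U hU'; have := D.κ_pos; intro h0; linarith
    simp only [hE, hawkingU, radius, hawking, nu, phiU, rphiU, rphi, primV_one]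
    norm_num
    field_simp
    ring
  have hEg : E V * D.factor U (X U) V = 0 := by
    refine eq_of_hasDerivAt_eq_Ici (f := fun V => E V * D.factor U (X U) V) (g := fun _ => 0)
      (f' := fun _ => 0) (fun V hV => ?_) (fun _ _ => hasDerivAt_const _ _)
      (by simp only [hE1, zero_mul]) hV
    exact ((hd V hV).mul (hasDerivAt_factor hU' hx hV)).congr_deriv (by ring)
  have : E V = 0 := (mul_eq_zero.1 hEg).resolve_right factor_pos.ne'
  exact sub_eq_zero.1 this

end IsEvolution
end IngoingData

namespace IngoingData

/-- The area radius of the solution determined by a curve of states. -/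
def solR (D : IngoingData) (X : ℝ → ConeFun × ConeFun) (q : ℝ × ℝ) : ℝ :=
  D.radius q.1 (X q.1) q.2

/-- The Hawking mass of the solution determined by a curve of states. -/
def solM (D : IngoingData) (X : ℝ → ConeFun × ConeFun) (q : ℝ × ℝ) : ℝ :=
  D.hawking q.1 (X q.1) q.2

/-- The scalar field of the solution determined by a curve of states. -/
def solφ (D : IngoingData) (X : ℝ → ConeFun × ConeFun) (q : ℝ × ℝ) : ℝ :=
  D.rphi q.1 (X q.1) q.2 / D.radius q.1 (X q.1) q.2

variable {D : IngoingData} {B a U V : ℝ} {x : ConeFun × ConeFun} {X : ℝ → ConeFun × ConeFun}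

lemma pv_solR (hV : 1 ≤ V) : pv (D.solR X) (U, V) = value (lam (X U)) V :=
  (hasDerivAt_radius (D := D) (U := U) (x := X U) hV).deriv

namespace IsEvolution

variable (h : D.IsEvolution B a X)
include h

section
variable (hU : U ∈ Ioo a 0)
include hU

lemma pu_solR : pu (D.solR X) (U, V) = D.nu U (X U) V := (h.hasDerivAt_radius hU).deriv

lemma pu_solM : pu (D.solM X) (U, V) = D.hawkingU X U V := (h.hasDerivAt_hawking hU).deriv

lemma pu_solφ (hV : 1 ≤ V) : pu (D.solφ X) (U, V) = D.phiU U (X U) V :=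
  (h.hasDerivAt_rphi_div_radius hU hV).deriv

lemma pv_solφ (hV : 1 ≤ V) : pv (D.solφ X) (U, V) = D.phiV U (X U) V :=
  (IngoingData.hasDerivAt_rphi_div_radius (h.Ioo_subset hU) (h.mem U) hV).deriv

lemma pv_solM (hV : 1 ≤ V) : pv (D.solM X) (U, V) =
    (D.radius U (X U) V - 2 * D.hawking U (X U) V) * D.radius U (X U) V *
      D.phiV U (X U) V ^ 2 / (2 * value (lam (X U)) V) :=
  (IngoingData.hasDerivAt_hawking (h.Ioo_subset hU) (h.mem U) hV).deriv

lemma pu_pv_solR (hV : 1 ≤ V) : pu (pv (D.solR X)) (U, V) = D.mixed U (X U) V := by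
  have : (fun t => pv (D.solR X) (t, V)) = fun t => value (lam (X t)) V :=
    funext fun t => pv_solR hV
  rw [pu, this]
  exact (h.hasDerivAt_lam hU hV).deriv

lemma pv_pu_solR (hV : 1 ≤ V) : pv (pu (D.solR X)) (U, V) = D.mixed U (X U) V := by
  have : (fun y => pu (D.solR X) (U, y)) = D.nu U (X U) := funext fun y => h.pu_solR hU
  rw [pv, this]
  exact (hasDerivAt_nu_mixed (h.Ioo_subset hU) (h.mem U) hV).deriv

lemma pu_pv_solφ (hV : 1 ≤ V) : pu (pv (D.solφ X)) (U, V) =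
    (-value (lam (X U)) V * D.phiU U (X U) V - D.nu U (X U) V * D.phiV U (X U) V) /
      D.radius U (X U) V := by
  refine ((h.hasDerivAt_phiV hU hV).congr_of_eventuallyEq ?_).deriv
  filter_upwards [Ioo_mem_nhds hU.1 hU.2] with t ht
  exact h.pv_solφ ht hV

end

lemma ssesf : SSESF (D.solR X) (D.solM X) (D.solφ X) (Ioo a 0 ×ˢ Ici 1) := by
  rintro ⟨U, V⟩ ⟨hU, hV⟩
  have hV : 1 ≤ V := hV
  have hU' := h.Ioo_subset hU
  have n1 := (radius_pos hU' (h.mem U) hV).ne'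
  have n2 := (gap_pos hU' (h.mem U) hV).ne'
  have n3 := (nu_neg hU' (h.mem U) hV).ne
  have n4 := (value_lam_pos (h.mem U) (V := V)).ne'
  have n5 : 1 - 2 * D.hawking U (X U) V / D.radius U (X U) V =
      (D.radius U (X U) V - 2 * D.hawking U (X U) V) / D.radius U (X U) V := by
    field_simp
  rw [h.pu_pv_solR hU hV, h.pv_pu_solR hU hV, h.pu_pv_solφ hU hV, h.pv_solM hU hV,
    h.pu_solM hU, h.pu_solR hU, pv_solR hV, h.pu_solφ hU hV, h.pv_solφ hU hV,
    h.hawkingU_eq hU hV]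
  simp only [solR, solM, n5, mixed]
  refine ⟨?_, ?_, ?_, ?_, ?_⟩ <;> field_simp
  ring

omit h in
lemma contDiffOn_primV {Y : ℝ → ConeFun} (hY : ContDiffOn ℝ 1 Y (Ioo a 0)) :
    ContDiffOn ℝ 1 (fun q : ℝ × ℝ => primV (Y q.1) q.2) (Ioo a 0 ×ˢ Ici 1) := by
  refine contDiff_prim.comp_contDiffOn (f := fun q : ℝ × ℝ => (Y q.1, 1 - q.2⁻¹)) ?_
  refine (hY.comp contDiffOn_fst fun _ hq => hq.1).prodMk (contDiffOn_const.sub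
    (contDiffOn_snd.inv fun q hq => ?_))
  exact (zero_lt_one.trans_le hq.2).ne'

lemma contDiffOn_solR : ContDiffOn ℝ 1 (D.solR X) (Ioo a 0 ×ˢ Ici 1) :=
  ((h.contDiffOn_r.comp contDiffOn_fst fun _ hq => hq.1).add
    ((contDiffOn_snd.sub contDiffOn_const).div_const 2)).add
    (contDiffOn_primV h.contDiffOn.fst)

lemma contDiffOn_solM : ContDiffOn ℝ 1 (D.solM X) (Ioo a 0 ×ˢ Ici 1) :=
  (h.contDiffOn_m.comp contDiffOn_fst fun _ hq => hq.1).add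
    (contDiffOn_primV h.contDiffOn_massFlux)

lemma contDiffOn_solφ : ContDiffOn ℝ 1 (D.solφ X) (Ioo a 0 ×ˢ Ici 1) :=
  (((h.contDiffOn_r.mul h.contDiffOn_φ).comp contDiffOn_fst fun _ hq => hq.1).add
    (contDiffOn_primV h.contDiffOn.snd)).div h.contDiffOn_solR fun q hq =>
      (radius_pos (h.Ioo_subset hq.1) (h.mem q.1) hq.2).ne'

end IsEvolution
end IngoingData

lemma ConeFun.abs_primV_le (x : ConeFun) {V : ℝ} (hV : 1 ≤ V) : |primV x V| ≤ ‖x‖ := by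
  have h : (1 - V⁻¹) ∈ Icc (0 : ℝ) 1 :=
    ⟨sub_nonneg.2 (inv_le_one_of_one_le₀ hV), sub_le_self _ (by positivity)⟩
  refine (abs_prim_le x _).trans (mul_le_of_le_one_right (norm_nonneg _) ?_)
  rw [abs_of_nonneg h.1]
  exact h.2

lemma ConeFun.tendsto_primV (x : ConeFun) : Tendsto (primV x) atTop (𝓝 (prim x 1)) := by
  have h : Tendsto (fun V : ℝ => 1 - V⁻¹) atTop (𝓝 1) := by
    simpa using tendsto_inv_atTop_zero.const_sub (1 : ℝ)
  exact (hasDerivAt_prim x 1).continuousAt.tendsto.comp h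

lemma ConeFun.abs_primV_sub_le (x : ConeFun) {V : ℝ} (hV : 0 < V) :
    |primV x V - prim x 1| ≤ ‖x‖ * V⁻¹ := by
  refine (prim_sub_le x _ _).trans_eq ?_
  rw [show 1 - V⁻¹ - 1 = -V⁻¹ by ring, abs_neg, abs_of_pos (inv_pos.2 hV)]

namespace IngoingData

variable {D : IngoingData} {B a U V : ℝ} {x : ConeFun × ConeFun} {X : ℝ → ConeFun × ConeFun}

/-- A constant that dominates the quantities controlling the geometry of admissible states. -/
structure Dominates (C : ℝ) (D : IngoingData) (B : ℝ) : Prop where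
  one_le : 1 ≤ C
  inv_le : C⁻¹ ≤ D.κ
  bound : B ≤ C
  ν : ∀ U ∈ Icc (-1 : ℝ) 0, |D.ν U| ≤ C
  rho : ∀ U ∈ Icc (-1 : ℝ) 0, ∀ x ∈ admissible D.κ B, ‖D.rho U x‖ ≤ C
  gam : ∀ U ∈ Icc (-1 : ℝ) 0, ∀ x ∈ admissible D.κ B, ‖D.gam U x‖ ≤ C
  accel : ∀ U ∈ Icc (-1 : ℝ) 0, ∀ x ∈ admissible D.κ B, ‖D.accel U x‖ ≤ C

lemma exists_dominates (D : IngoingData) (B : ℝ) : ∃ C, Dominates C D B := by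
  obtain ⟨C₁, h₁, c₁⟩ := (D.tame_rho B).bdd
  obtain ⟨C₂, h₂, c₂⟩ := (D.tame_gam B).bdd
  obtain ⟨C₃, h₃, c₃⟩ := (D.tame_accel B).bdd
  obtain ⟨C₄, c₄⟩ := isCompact_Icc.exists_bound_of_continuousOn
    (D.cont_ν.continuousOn (s := Icc (-1) 0))
  have h₄ : 0 ≤ C₄ := (norm_nonneg _).trans (c₄ 0 (by simp))
  have hκ := D.κ_pos
  have hκ' : 0 < D.κ⁻¹ := inv_pos.2 hκ
  have hB := abs_nonneg B
  have hB' := le_abs_self B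
  refine ⟨1 + D.κ⁻¹ + |B| + C₁ + C₂ + C₃ + C₄, by linarith, ?_, by linarith,
    fun U hU => (c₄ U hU).trans (by linarith), fun U hU x hx => (c₁ U hU x hx).trans (by linarith),
    fun U hU x hx => (c₂ U hU x hx).trans (by linarith),
    fun U hU x hx => (c₃ U hU x hx).trans (by linarith)⟩
  exact inv_le_of_inv_le₀ hκ (by linarith)

namespace Dominates

variable {C : ℝ} (hC : Dominates C D B) (hU : U ∈ Icc (-1 : ℝ) 0) (hx : x ∈ admissible D.κ B)
include hC

lemma pos : 0 < C := zero_lt_one.trans_le hC.one_le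

include hU hx

lemma radius_le (hV : 1 ≤ V) : D.radius U x V ≤ C * V := by
  have h0 : 0 < V := by positivity
  have := (le_abs_self _).trans ((abs_value_le (D.rho U x) V).trans (hC.rho U hU x hx))
  rw [value_rho hV, inv_mul_le_iff₀ h0] at this
  linarith

omit hU in
lemma radius_ge (hU : U ∈ Icc (-1 : ℝ) 0) (hV : 1 ≤ V) : C⁻¹ * V ≤ D.radius U x V :=
  (mul_le_mul_of_nonneg_right hC.inv_le (by positivity)).trans
    (IngoingData.radius_ge hU hx hV)

lemma factor_le (hV : 1 ≤ V) : D.factor U x V ≤ C := by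
  rw [← value_gam hV]
  exact (le_abs_self _).trans ((abs_value_le (D.gam U x) V).trans (hC.gam U hU x hx))

lemma gap_ge (hV : 1 ≤ V) :
    C⁻¹ ^ 3 ≤ (D.radius U x V - 2 * D.hawking U x V) / D.radius U x V := by
  have hc := hC.pos
  have h0 := radius_pos hU hx hV
  have h1 := gap_pos hU hx hV
  have h2 := factor_mul_gap_ge hU hx hV
  have h3 : C⁻¹ * V ≤ C * (D.radius U x V - 2 * D.hawking U x V) :=
    (mul_le_mul_of_nonneg_right hC.inv_le (by positivity)).trans (h2.trans
      (mul_le_mul_of_nonneg_right (hC.factor_le hU hx hV) h1.le))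
  rw [le_div_iff₀ h0]
  calc C⁻¹ ^ 3 * D.radius U x V ≤ C⁻¹ ^ 3 * (C * V) := by
        gcongr; exact hC.radius_le hU hx hV
    _ = C⁻¹ * (C⁻¹ * V) := by field_simp
    _ ≤ C⁻¹ * (C * (D.radius U x V - 2 * D.hawking U x V)) := by gcongr
    _ = D.radius U x V - 2 * D.hawking U x V := by field_simp

omit hx in
lemma neg_γ_ge : C⁻¹ ≤ -D.γ U := by
  have h1 := D.κ_pos.trans_le (D.r_ge U hU)
  have h2 := D.κ_pos.trans_le (D.gap U hU)
  have h3 := D.ν_le U hU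
  have h4 := D.m_nonneg U hU
  have h5 := D.κ_pos
  rw [γ, ← neg_div, le_div_iff₀ h2]
  calc C⁻¹ * (D.r U - 2 * D.m U) ≤ -D.ν U * D.r U :=
        mul_le_mul (hC.inv_le.trans h3) (by linarith) h2.le (by linarith)
    _ = -(D.ν U * D.r U) := by ring

lemma neg_nu_ge (hV : 1 ≤ V) : C⁻¹ ^ 3 ≤ -D.nu U x V := by
  have hc := hC.pos
  have h0 := radius_pos hU hx hV
  have h1 := hC.neg_γ_ge hU
  rw [nu_eq_gap hU hx hV]
  have h2 : C⁻¹ ^ 2 ≤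
      D.factor U x V * (D.radius U x V - 2 * D.hawking U x V) / D.radius U x V := by
    rw [le_div_iff₀ h0]
    calc C⁻¹ ^ 2 * D.radius U x V ≤ C⁻¹ ^ 2 * (C * V) := by
          gcongr; exact hC.radius_le hU hx hV
      _ = C⁻¹ * V := by field_simp
      _ ≤ D.κ * V := by gcongr; exact hC.inv_le
      _ ≤ _ := factor_mul_gap_ge hU hx hV
  calc C⁻¹ ^ 3 = C⁻¹ * C⁻¹ ^ 2 := by ring
    _ ≤ -D.γ U * (D.factor U x V * (D.radius U x V - 2 * D.hawking U x V) / D.radius U x V) :=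
        mul_le_mul h1 h2 (by positivity) (by linarith [inv_pos.2 hc])
    _ = _ := by ring

lemma abs_nu_le (hV : 1 ≤ V) : |D.nu U x V| ≤ 2 * C := by
  have h1 := abs_add_le (D.ν U) (primV (D.accel U x) V)
  have h2 := (abs_primV_le (D.accel U x) hV).trans (hC.accel U hU x hx)
  have h3 := hC.ν U hU
  rw [nu]
  linarith

omit hU

lemma abs_lam_sub_le (hV : 1 ≤ V) : |value (lam x) V - 1 / 2| ≤ C * V⁻¹ ^ 2 := by
  rw [value_lam hV, add_sub_cancel_left, abs_mul, abs_of_nonneg (by positivity), mul_comm]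
  exact mul_le_mul_of_nonneg_right ((abs_value_le _ _).trans (hx.1.trans hC.bound))
    (by positivity)

lemma abs_rphi_deriv_le : |V⁻¹ ^ 2 * value x.2 V| ≤ C * V⁻¹ ^ 2 := by
  rw [abs_mul, abs_of_nonneg (by positivity), mul_comm]
  exact mul_le_mul_of_nonneg_right ((abs_value_le _ _).trans (hx.2.1.trans hC.bound))
    (by positivity)

lemma lam_le (hV : 1 ≤ V) : value (lam x) V ≤ 2 * C := by
  have h1 := (abs_le.1 (hC.abs_lam_sub_le hx hV)).2
  have h2 : C * V⁻¹ ^ 2 ≤ C :=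
    mul_le_of_le_one_right hC.pos.le (pow_le_one₀ (by positivity) (inv_le_one_of_one_le₀ hV))
  linarith [hC.one_le]

end Dominates

end IngoingData

namespace IngoingData

variable {D : IngoingData} {B a C U V : ℝ} {X : ℝ → ConeFun × ConeFun}

/-- The limit of `∂_U r` as `V → ∞`. -/
def nuInf (D : IngoingData) (X : ℝ → ConeFun × ConeFun) (U : ℝ) : ℝ :=
  D.ν U + prim (D.accel U (X U)) 1

lemma Dominates.inv_two_mul_le (hC : Dominates C D B) : (2 * C ^ 3)⁻¹ ≤ C⁻¹ ^ 3 := by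
  have := hC.pos
  rw [inv_pow]
  gcongr
  exact le_mul_of_one_le_left (by positivity) one_le_two

lemma Dominates.inv_pow_le (hC : Dominates C D B) : C⁻¹ ^ 3 ≤ C⁻¹ :=
  pow_le_of_le_one (inv_nonneg.2 hC.pos.le) (inv_le_one_of_one_le₀ hC.one_le) (by norm_num)

lemma Dominates.two_mul_le (hC : Dominates C D B) : 2 * C ≤ 2 * C ^ 3 := by
  gcongr
  exact le_self_pow₀ hC.one_le (by norm_num)

namespace IsEvolution

variable (h : D.IsEvolution B a X) (hC : Dominates C D B) (hU : U ∈ Ioo a 0)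
include h hU

lemma solR_mul_solφ (hV : 1 ≤ V) : D.solR X (U, V) * D.solφ X (U, V) = D.rphi U (X U) V :=
  mul_div_cancel₀ _ (radius_pos (h.Ioo_subset hU) (h.mem U) hV).ne'

lemma pv_solR_mul_solφ (hV : 1 < V) :
    pv (fun q => D.solR X q * D.solφ X q) (U, V) = V⁻¹ ^ 2 * value (X U).2 V := by
  refine ((IngoingData.hasDerivAt_rphi (D := D) (U := U) (x := X U)
    (by positivity)).congr_of_eventuallyEq ?_).deriv
  filter_upwards [Ioi_mem_nhds hV] with y hy
  exact h.solR_mul_solφ hU (le_of_lt hy)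

lemma tendsto_pu_solR : Tendsto (fun V => pu (D.solR X) (U, V)) atTop (𝓝 (D.nuInf X U)) := by
  simp only [h.pu_solR hU]
  exact (tendsto_primV _).const_add _

omit h hU in
lemma tendsto_solM :
    Tendsto (fun V => D.solM X (U, V)) atTop (𝓝 (D.m U + prim (D.massFlux U (X U)) 1)) :=
  (tendsto_primV _).const_add _

lemma tendsto_solR_mul_solφ : Tendsto (fun V => D.solR X (U, V) * D.solφ X (U, V)) atTop
    (𝓝 (D.r U * D.φ U + prim (X U).2 1)) := by
  refine ((tendsto_primV (X U).2).const_add (D.r U * D.φ U)).congr' ?_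
  filter_upwards [eventually_ge_atTop 1] with V hV
  exact (h.solR_mul_solφ hU hV).symm

lemma tendsto_solR : Tendsto (fun V => D.solR X (U, V)) atTop atTop := by
  refine tendsto_atTop_mono' _ ?_ (tendsto_id.const_mul_atTop D.κ_pos)
  filter_upwards [eventually_ge_atTop 1] with V hV
  exact IngoingData.radius_ge (h.Ioo_subset hU) (h.mem U) hV

lemma solM_div_solR_nonneg (hV : 1 ≤ V) : 0 ≤ 2 * D.solM X (U, V) / D.solR X (U, V) :=
  div_nonneg (mul_nonneg two_pos.le (hawking_nonneg (h.Ioo_subset hU) (h.mem U) hV))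
    (radius_pos (h.Ioo_subset hU) (h.mem U) hV).le

include hC

lemma solM_div_solR_le (hV : 1 ≤ V) :
    2 * D.solM X (U, V) / D.solR X (U, V) ≤ 1 - C⁻¹ ^ 3 := by
  have h1 := hC.gap_ge (h.Ioo_subset hU) (h.mem U) hV
  rw [sub_div, div_self (radius_pos (h.Ioo_subset hU) (h.mem U) hV).ne'] at h1
  change 2 * D.hawking U (X U) V / D.radius U (X U) V ≤ _
  linarith

lemma solution_bounds (hV : 1 < V) :
    ((2 * C ^ 3)⁻¹ * V ≤ D.solR X (U, V) ∧ D.solR X (U, V) ≤ 2 * C ^ 3 * V) ∧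
    ((2 * C ^ 3)⁻¹ ≤ -pu (D.solR X) (U, V) ∧ -pu (D.solR X) (U, V) ≤ 2 * C ^ 3) ∧
    ((2 * C ^ 3)⁻¹ ≤ pv (D.solR X) (U, V) ∧ pv (D.solR X) (U, V) ≤ 2 * C ^ 3) ∧
    (0 ≤ 2 * D.solM X (U, V) / D.solR X (U, V) ∧
      2 * D.solM X (U, V) / D.solR X (U, V) ≤ 1 - C⁻¹ ^ 3) ∧
    |pv (D.solR X) (U, V) - 1 / 2| ≤ 2 * C ^ 3 * V ^ (-2 : ℝ) ∧
    |pv (fun q => D.solR X q * D.solφ X q) (U, V)| ≤ 2 * C ^ 3 * V ^ (-2 : ℝ) := by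
  have hU' := h.Ioo_subset hU
  have hx := h.mem U
  have h0 : 0 < V := by positivity
  have e : V ^ (-2 : ℝ) = V⁻¹ ^ 2 := by
    rw [Real.rpow_neg h0.le, inv_pow]
    norm_cast
  have l1 := hC.inv_two_mul_le
  have l2 := hC.inv_pow_le
  have l3 := hC.two_mul_le
  have l4 : C ≤ 2 * C ^ 3 := by linarith [hC.pos]
  rw [pv_solR hV.le, h.pu_solR hU, h.pv_solR_mul_solφ hU hV, e]
  refine ⟨⟨?_, ?_⟩, ⟨l1.trans (hC.neg_nu_ge hU' hx hV.le), ?_⟩,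
    ⟨(l1.trans l2).trans (hC.inv_le.trans (lam_ge hx _)), (hC.lam_le hx hV.le).trans l3⟩,
    ⟨h.solM_div_solR_nonneg hU hV.le, h.solM_div_solR_le hC hU hV.le⟩, ?_, ?_⟩
  · exact (mul_le_mul_of_nonneg_right (l1.trans l2) h0.le).trans (hC.radius_ge hx hU' hV.le)
  · exact (hC.radius_le hU' hx hV.le).trans (mul_le_mul_of_nonneg_right l4 h0.le)
  · exact (neg_le_abs _).trans ((hC.abs_nu_le hU' hx hV.le).trans l3)
  · exact (hC.abs_lam_sub_le hx hV.le).trans (mul_le_mul_of_nonneg_right l4 (by positivity))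
  · exact (hC.abs_rphi_deriv_le hx).trans (mul_le_mul_of_nonneg_right l4 (by positivity))

lemma abs_pu_solR_sub_nuInf_le (hV : 1 < V) :
    |pu (D.solR X) (U, V) - D.nuInf X U| ≤ 2 * C ^ 3 * V⁻¹ := by
  have h0 : 0 < V := by positivity
  rw [h.pu_solR hU, nu, nuInf, add_sub_add_left_eq_sub]
  refine (abs_primV_sub_le _ h0).trans (mul_le_mul_of_nonneg_right ?_ (by positivity))
  linarith [hC.accel U (h.Ioo_subset hU) _ (h.mem U), hC.two_mul_le, hC.pos]

lemma neg_nuInf_mem : -D.nuInf X U ∈ Icc (2 * C ^ 3)⁻¹ (2 * C ^ 3) := by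
  refine isClosed_Icc.mem_of_tendsto (h.tendsto_pu_solR hU).neg ?_
  filter_upwards [eventually_gt_atTop 1] with V hV
  exact (h.solution_bounds hC hU hV).2.1

omit hU in
lemma integral_le {b : ℝ} (hab : a < b) (hb : b < 0) (hV : 1 < V) :
    ∫ U in b..(0 : ℝ), -4 * pv (D.solR X) (U, V) * pu (D.solR X) (U, V) /
      (1 - 2 * D.solM X (U, V) / D.solR X (U, V)) ≤ 4 * (2 * C ^ 3) ^ 2 * C ^ 3 * |0 - b| := by
  refine (Real.le_norm_self _).trans
    (intervalIntegral.norm_integral_le_of_norm_le_const_ae ?_)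
  have hz : ∀ᵐ U : ℝ, U ≠ 0 := by simp [ae_iff]
  filter_upwards [hz] with U hU0 hU
  rw [uIoc_of_le hb.le] at hU
  have hU' : U ∈ Ioo a 0 := ⟨hab.trans hU.1, lt_of_le_of_ne hU.2 hU0⟩
  obtain ⟨-, ⟨h1, h2⟩, ⟨h3, h4⟩, ⟨-, h6⟩, -⟩ := h.solution_bounds hC hU' hV
  have hc := hC.pos
  have h7 : C⁻¹ ^ 3 ≤ 1 - 2 * D.solM X (U, V) / D.solR X (U, V) := by linarith
  have h8 : 0 < C⁻¹ ^ 3 := by positivity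
  have h9 : 0 < (2 * C ^ 3)⁻¹ := by positivity
  rw [Real.norm_eq_abs, abs_div, abs_of_pos (h8.trans_le h7), div_le_iff₀ (h8.trans_le h7),
    show -4 * pv (D.solR X) (U, V) * pu (D.solR X) (U, V) =
      4 * (pv (D.solR X) (U, V) * -pu (D.solR X) (U, V)) by ring,
    abs_of_nonneg (by have := h9.trans_le h1; have := h9.trans_le h3; positivity)]
  calc 4 * (pv (D.solR X) (U, V) * -pu (D.solR X) (U, V))
      ≤ 4 * (2 * C ^ 3 * (2 * C ^ 3)) := by gcongr; exact h9.le.trans h1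
    _ = 4 * (2 * C ^ 3) ^ 2 * C ^ 3 * C⁻¹ ^ 3 := by field_simp
    _ ≤ _ := by gcongr

end IsEvolution
end IngoingData

lemma exists_continuous_eqOn_Ioo {f : ℝ → ℝ} {C : ℝ} (hf : DifferentiableOn ℝ f (Ioo (-1) 0))
    (hC : ∀ U ∈ Ioo (-1 : ℝ) 0, |deriv f U| ≤ C) :
    ∃ g, Continuous g ∧ EqOn f g (Ioo (-1) 0) := by
  have h := (convex_Ioo (-1 : ℝ) 0).lipschitzOnWith_of_nnnorm_deriv_le (C := C.toNNReal)
    (fun U hU => (hf U hU).differentiableAt (Ioo_mem_nhds hU.1 hU.2))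
    (fun U hU => by
      rw [← NNReal.coe_le_coe, coe_nnnorm, Real.norm_eq_abs]
      exact (hC U hU).trans (Real.le_coe_toNNReal C))
  obtain ⟨g, hg, e⟩ := h.extend_real
  exact ⟨g, hg.continuous, e⟩

lemma le_on_Icc_of_le_on_Ioo {g : ℝ → ℝ} {c : ℝ} (hg : Continuous g)
    (h : ∀ U ∈ Ioo (-1 : ℝ) 0, c ≤ g U) : ∀ U ∈ Icc (-1 : ℝ) 0, c ≤ g U := by
  rw [← closure_Ioo (by norm_num)]
  exact le_on_closure h continuousOn_const hg.continuousOn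

lemma HasDerivAt.congr_of_eqOn_Ioo {f g : ℝ → ℝ} {f' U : ℝ} (hU : U ∈ Ioo (-1 : ℝ) 0)
    (e : EqOn f g (Ioo (-1) 0)) (hf : HasDerivAt f f' U) : HasDerivAt g f' U :=
  hf.congr_of_eventuallyEq
    (e.symm.eventuallyEq_of_mem (Ioo_mem_nhds hU.1 hU.2))

lemma exists_ingoingData {r m φ : ℝ → ℝ} {C c : ℝ} (hC : 1 ≤ C) (hc : c < 1)
    (hr : ContDiffOn ℝ 2 r (Ioo (-1) 0)) (hm : ContDiffOn ℝ 2 m (Ioo (-1) 0))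
    (hφ : ContDiffOn ℝ 2 φ (Ioo (-1) 0))
    (r_mem : ∀ U ∈ Ioo (-1 : ℝ) 0, r U ∈ Icc C⁻¹ C)
    (deriv_r_mem : ∀ U ∈ Ioo (-1 : ℝ) 0, -deriv r U ∈ Icc C⁻¹ C)
    (deriv_deriv_r : ∀ U ∈ Ioo (-1 : ℝ) 0, |deriv (deriv r) U| ≤ C)
    (deriv_φ : ∀ U ∈ Ioo (-1 : ℝ) 0, |deriv φ U| ≤ C)
    (ratio_mem : ∀ U ∈ Ioo (-1 : ℝ) 0, 2 * m U / r U ∈ Icc 0 c)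
    (constraint : ∀ U ∈ Ioo (-1 : ℝ) 0,
      2 * deriv r U * deriv m U = r U ^ 2 * (1 - 2 * m U / r U) * deriv φ U ^ 2) :
    ∃ D : IngoingData, D.κ ≤ C⁻¹ / 4 ∧ EqOn r D.r (Ioo (-1) 0) ∧
      EqOn (deriv r) D.ν (Ioo (-1) 0) ∧ EqOn φ D.φ (Ioo (-1) 0) := by
  have hC0 : 0 < C⁻¹ := inv_pos.2 (by linarith)
  have hC1 : C⁻¹ ≤ 1 := inv_le_one_of_one_le₀ hC
  have hc0 : 0 ≤ c := by
    have := ratio_mem (-1 / 2) (by norm_num)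
    exact this.1.trans this.2
  have hκ : (1 - c) * C⁻¹ / 4 ≤ C⁻¹ / 4 := by nlinarith
  have ratio : ∀ U ∈ Ioo (-1 : ℝ) 0, 0 ≤ m U ∧ (1 - c) * C⁻¹ ≤ r U - 2 * m U ∧ r U ≤ C := by
    intro U hU
    obtain ⟨h1, h2⟩ := r_mem U hU
    obtain ⟨h3, h4⟩ := ratio_mem U hU
    have h0 := hC0.trans_le h1
    rw [div_le_iff₀ h0] at h4
    refine ⟨?_, ?_, h2⟩
    · by_contra! hneg
      exact absurd h3 (not_le.2 (div_neg_of_neg_of_pos (by linarith) h0))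
    · nlinarith
  have dm : ∀ U ∈ Ioo (-1 : ℝ) 0,
      deriv m U = (r U - 2 * m U) * r U * deriv φ U ^ 2 / (2 * deriv r U) := by
    intro U hU
    have h0 : r U ≠ 0 := (hC0.trans_le (r_mem U hU).1).ne'
    have h1 : deriv r U ≠ 0 := (neg_pos.1 (hC0.trans_le (deriv_r_mem U hU).1)).ne
    have h2 := constraint U hU
    field_simp at h2 ⊢
    linarith
  have dm_le : ∀ U ∈ Ioo (-1 : ℝ) 0, |deriv m U| ≤ C * C * C ^ 2 / (2 * C⁻¹) := by
    intro U hU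
    obtain ⟨h1, h2, h3⟩ := ratio U hU
    have h4 := hC0.trans_le (r_mem U hU).1
    have h5 := (deriv_r_mem U hU).1
    have h6 : 0 ≤ r U - 2 * m U := le_trans (mul_nonneg (by linarith) hC0.le) h2
    rw [dm U hU, abs_div, abs_mul, abs_mul, abs_pow, abs_mul, abs_of_pos h4, abs_of_nonneg h6,
      abs_two]
    gcongr
    · linarith
    · exact deriv_φ U hU
    · exact h5.trans (neg_le_abs _)
  have dr := hr.differentiableOn two_ne_zero
  have dφ := hφ.differentiableOn two_ne_zero
  have cdr := (hr.deriv_of_isOpen (m := 1) isOpen_Ioo le_rfl).differentiableOn one_ne_zero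
  obtain ⟨r', cr, er⟩ := exists_continuous_eqOn_Ioo dr (C := C)
    fun U hU => by
      have := deriv_r_mem U hU
      exact abs_le.2 ⟨by linarith [this.2], by linarith [this.1]⟩
  obtain ⟨ν, cν, eν⟩ := exists_continuous_eqOn_Ioo cdr deriv_deriv_r
  obtain ⟨φ', cφ, eφ⟩ := exists_continuous_eqOn_Ioo dφ deriv_φ
  obtain ⟨m', cm, em⟩ := exists_continuous_eqOn_Ioo (hm.differentiableOn two_ne_zero) dm_le
  have hasDeriv {f : ℝ → ℝ} (hf : DifferentiableOn ℝ f (Ioo (-1) 0)) {U : ℝ}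
      (hU : U ∈ Ioo (-1 : ℝ) 0) : HasDerivAt f (deriv f U) U :=
    ((hf U hU).differentiableAt (Ioo_mem_nhds hU.1 hU.2)).hasDerivAt
  refine ⟨⟨r', ν, φ', deriv φ, m', (1 - c) * C⁻¹ / 4, ?_, ?_, cr, cν, cφ, cm, ?_, ?_, ?_, ?_, ?_,
    ?_, ?_, ?_⟩, hκ, er, eν, eφ⟩
  · exact div_pos (mul_pos (by linarith) hC0) (by norm_num)
  · linarith
  · exact (hφ.deriv_of_isOpen (m := 1) isOpen_Ioo le_rfl).continuousOn
  · refine le_on_Icc_of_le_on_Ioo cr fun U hU => ?_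
    rw [← er hU]
    linarith [(r_mem U hU).1]
  · refine le_on_Icc_of_le_on_Ioo cm fun U hU => ?_
    rw [← em hU]
    exact (ratio U hU).1
  · refine le_on_Icc_of_le_on_Ioo (cr.sub (continuous_const.mul cm)) fun U hU => ?_
    rw [← em hU, ← er hU]
    linarith [(ratio U hU).2.1, mul_nonneg (sub_nonneg.2 hc.le) hC0.le]
  · refine le_on_Icc_of_le_on_Ioo cν.neg fun U hU => ?_
    rw [← eν hU]
    linarith [(deriv_r_mem U hU).1]
  · intro U hU
    rw [← eν hU]
    exact (hasDeriv dr hU).congr_of_eqOn_Ioo hU er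
  · intro U hU
    exact (hasDeriv dφ hU).congr_of_eqOn_Ioo hU eφ
  · intro U hU
    rw [← eν hU, ← em hU, ← er hU, ← dm U hU]
    exact (hasDeriv (hm.differentiableOn two_ne_zero) hU).congr_of_eqOn_Ioo hU em

lemma exists_coneFun {L : ℝ → ℝ} {C : ℝ} (hL : ContinuousOn L (Ici 1))
    (hzero : ∀ V, 2 < V → L V = 0) (hC : ∀ V ∈ Icc (1 : ℝ) 2, |L V| ≤ C) :
    ∃ x : ConeFun, ‖x‖ ≤ C ∧ ∀ V, 1 ≤ V → value x V = L V := by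
  have hC0 : 0 ≤ C := (abs_nonneg _).trans (hC 1 (by norm_num))
  have hpos (s : unitInterval) : 0 < 1 - min (s : ℝ) (3 / 4) := by
    have := min_le_right (s : ℝ) (3 / 4)
    linarith
  have hone (s : unitInterval) : 1 ≤ (1 - min (s : ℝ) (3 / 4))⁻¹ :=
    (one_le_inv₀ (hpos s)).2 (sub_le_self _ (le_min s.2.1 (by norm_num)))
  have hcont : Continuous fun s : unitInterval => L (1 - min (s : ℝ) (3 / 4))⁻¹ :=
    hL.comp_continuous (Continuous.inv₀ (by fun_prop) fun s => (hpos s).ne') hone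
  refine ⟨⟨_, hcont⟩, (ContinuousMap.norm_le _ hC0).2 fun s => ?_, fun V hV => ?_⟩
  · change |L (1 - min (s : ℝ) (3 / 4))⁻¹| ≤ C
    rcases le_or_gt (1 - min (s : ℝ) (3 / 4))⁻¹ 2 with h | h
    · exact hC _ ⟨hone s, h⟩
    · rw [hzero _ h, abs_zero]
      exact hC0
  · change L (1 - min (clampI (1 - V⁻¹) : ℝ) (3 / 4))⁻¹ = L V
    rw [coe_clampI hV]
    rcases le_or_gt V 4 with h | h
    · have : 4⁻¹ ≤ V⁻¹ := inv_anti₀ (by positivity) h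
      rw [min_eq_left (by linarith), sub_sub_cancel, inv_inv]
    · have : V⁻¹ ≤ 4⁻¹ := inv_anti₀ (by norm_num) h.le
      rw [min_eq_right (by linarith), hzero V (by linarith), hzero _ (by norm_num)]

lemma mem_admissible {κ B : ℝ} {x : ConeFun × ConeFun} (hκ : κ ≤ 1 / 2) (h1 : ‖x.1‖ ≤ B)
    (h2 : ‖x.2‖ ≤ B) (h : ∀ V, 1 ≤ V → κ ≤ value (lam x) V) : x ∈ admissible κ B := by
  refine ⟨h1, h2, fun s => ?_⟩
  rcases s.2.2.eq_or_lt with hs | hs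
  · simpa [hs] using hκ
  · have h3 := sub_pos.2 hs
    have h4 : 1 ≤ (1 - (s : ℝ))⁻¹ := (one_le_inv₀ h3).2 (sub_le_self _ s.2.1)
    have h5 := h _ h4
    have h6 : clampI (1 - (1 - (s : ℝ))⁻¹⁻¹) = s := by
      ext
      rw [coe_clampI h4, inv_inv, sub_sub_cancel]
    rwa [value, h6, lam_apply] at h5

/-- Regularity and bounds, with constant `C`, of the area radius `r` and the scalar field `f` along
an outgoing cone `{U = const, V ≥ 1}`. -/
structure OutgoingBounds (C : ℝ) (r f : ℝ → ℝ) : Prop where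
  one_le : 1 ≤ C
  smooth_r : ContDiffOn ℝ 2 r (Ici 1)
  smooth_f : ContDiffOn ℝ 2 f (Ici 1)
  r_le : |r 1| ≤ C
  deriv_r_mem : ∀ V, 1 ≤ V → deriv r V ∈ Icc C⁻¹ C
  f_le : ∀ V, 1 ≤ V → |f V| ≤ C
  deriv_f_le : ∀ V, 1 ≤ V → |deriv f V| ≤ C

namespace OutgoingBounds

variable {C C₁ : ℝ} {r f χ : ℝ → ℝ}

lemma abs_derivWithin_f_le (h : OutgoingBounds C r f) {V : ℝ} (hV : 1 ≤ V) :
    |derivWithin f (Ici 1) V| ≤ C := by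
  rw [← mem_Ici, ← closure_Ioi] at hV
  refine le_on_closure (s := Ioi 1) (f := fun V => |derivWithin f (Ici 1) V|) (g := fun _ => C)
    (fun y hy => ?_) ?_ continuousOn_const hV
  · rw [derivWithin_of_mem_nhds (Ici_mem_nhds hy)]
    exact h.deriv_f_le y (le_of_lt hy)
  · rw [closure_Ioi]
    exact (h.smooth_f.continuousOn_derivWithin (uniqueDiffOn_Ici 1) one_le_two).abs

lemma hasDerivAt_r (h : OutgoingBounds C r f) {V : ℝ} (hV : 1 ≤ V) :
    HasDerivAt r (deriv r V) V :=
  (differentiableAt_of_deriv_ne_zero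
    ((inv_pos.2 (zero_lt_one.trans_le h.one_le)).trans_le
      (h.deriv_r_mem V hV).1).ne').hasDerivAt

lemma continuousOn_deriv_r (h : OutgoingBounds C r f) : ContinuousOn (deriv r) (Ici 1) :=
  (h.smooth_r.continuousOn_derivWithin (uniqueDiffOn_Ici 1) one_le_two).congr fun V hV =>
    ((h.hasDerivAt_r hV).hasDerivWithinAt.derivWithin (uniqueDiffOn_Ici 1 V hV)).symm

lemma exists_initial_state (h : OutgoingBounds C r f) (hχ : ContDiff ℝ 1 χ)
    (hχone : χ 1 = 1) (hχzero : ∀ V, 2 ≤ V → χ V = 0) (hχrange : ∀ V, 0 ≤ χ V ∧ χ V ≤ 1)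
    (hχ' : ∀ V, |deriv χ V| ≤ C₁) :
    ∃ x ∈ admissible (C⁻¹ / 2) (32 * C ^ 2 * (C₁ + 1)),
      (∀ V, 1 ≤ V → value (lam x) V = χ V * deriv r V + 1 / 2 * (1 - χ V)) ∧
      ∀ D : IngoingData, ∀ U, D.r U = r 1 → D.φ U = f 1 → ∀ V, 1 ≤ V →
        D.rphi U x V = D.radius U x V * (χ V * f V) := by
  have hC := h.one_le
  have hC0 : 0 < C := by linarith
  have hCi : C⁻¹ ≤ 1 := inv_le_one_of_one_le₀ hC
  have hC₁ : 0 ≤ C₁ := (abs_nonneg _).trans (hχ' 0)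
  have χc := hχ.continuous.continuousOn (s := Ici 1)
  have χc' := (hχ.continuous_deriv le_rfl).continuousOn (s := Ici 1)
  have dχ (V : ℝ) : HasDerivAt χ (deriv χ V) V := (hχ.differentiable one_ne_zero V).hasDerivAt
  have χ_le (V : ℝ) : |χ V| ≤ 1 := abs_le.2 ⟨by linarith [(hχrange V).1], (hχrange V).2⟩
  have dχ_zero (V : ℝ) (hV : 2 < V) : deriv χ V = 0 := by
    refine ((hasDerivAt_const V (0 : ℝ)).congr_of_eventuallyEq ?_).deriv
    filter_upwards [Ioi_mem_nhds hV] with y hy using hχzero y (le_of_lt hy)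
  have sq_le (V : ℝ) (hV : V ∈ Icc (1 : ℝ) 2) : |V ^ 2| ≤ 4 := by
    rw [abs_of_nonneg (sq_nonneg V)]
    nlinarith [hV.1, hV.2]
  have dr_le (V : ℝ) (hV : 1 ≤ V) : |deriv r V - 1 / 2| ≤ C := by
    obtain ⟨h1, h2⟩ := h.deriv_r_mem V hV
    have := inv_pos.2 hC0
    exact abs_le.2 ⟨by linarith, by linarith⟩
  obtain ⟨ℓ, ℓ_le, hℓ⟩ := exists_coneFun (L := fun V => V ^ 2 * (χ V * (deriv r V - 1 / 2)))
    (C := 4 * C)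
    (((continuous_pow 2).continuousOn).mul (χc.mul (h.continuousOn_deriv_r.sub continuousOn_const)))
    (fun V hV => by simp [hχzero V hV.le])
    (fun V hV => by
      rw [abs_mul, abs_mul]
      calc _ ≤ 4 * (1 * C) := by
            gcongr
            exacts [sq_le V hV, χ_le V, dr_le V hV.1]
        _ = _ := by ring)
  have hlam (z : ConeFun) (V : ℝ) (hV : 1 ≤ V) :
      value (lam (ℓ, z)) V = χ V * deriv r V + 1 / 2 * (1 - χ V) := by
    rw [IngoingData.value_lam hV, hℓ V hV]
    field_simp
    ring
  let lamV : ℝ → ℝ := fun V => χ V * deriv r V + 1 / 2 * (1 - χ V)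
  let rad : ℝ → ℝ := fun V => r 1 + (V - 1) / 2 + primV ℓ V
  have drad (V : ℝ) (hV : 1 ≤ V) : HasDerivAt rad (lamV V) V := by
    refine (((((hasDerivAt_id V).sub_const 1).div_const 2).const_add (r 1)).add
      (hasDerivAt_primV ℓ (by positivity))).congr_deriv ?_
    exact (IngoingData.value_lam (x := (ℓ, 0)) hV).symm.trans (hlam 0 V hV)
  let df : ℝ → ℝ := derivWithin f (Ici 1)
  have ddf (V : ℝ) (hV : 1 ≤ V) : HasDerivWithinAt f (df V) (Ici 1) V :=
    (h.smooth_f.differentiableOn two_ne_zero V hV).hasDerivWithinAt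
  have lamV_mem (V : ℝ) (hV : 1 ≤ V) : C⁻¹ / 2 ≤ lamV V ∧ lamV V ≤ C := by
    obtain ⟨h1, h2⟩ := h.deriv_r_mem V hV
    obtain ⟨h3, h4⟩ := hχrange V
    have h5 := inv_pos.2 hC0
    simp only [lamV]
    constructor
    · nlinarith [mul_nonneg h3 (sub_nonneg.2 h1), mul_nonneg h3 h5.le,
        mul_nonneg (sub_nonneg.2 h4) (sub_nonneg.2 hCi)]
    · nlinarith [mul_nonneg h3 (sub_nonneg.2 h2), mul_nonneg (sub_nonneg.2 h4) (sub_nonneg.2 hC)]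
  obtain ⟨z, z_le, hz⟩ := exists_coneFun
    (L := fun V => V ^ 2 * (lamV V * (χ V * f V) + rad V * (deriv χ V * f V + χ V * df V)))
    (C := 4 * (C * (1 * C) + (6 * C) * (C₁ * C + 1 * C)))
    (by
      have c1 : ContinuousOn rad (Ici 1) := fun V hV =>
        (drad V hV).continuousAt.continuousWithinAt
      have c2 := h.continuousOn_deriv_r
      have c3 := h.smooth_f.continuousOn
      have c4 : ContinuousOn df (Ici 1) :=
        h.smooth_f.continuousOn_derivWithin (uniqueDiffOn_Ici 1) one_le_two
      fun_prop)
    (fun V hV => by simp [hχzero V hV.le, dχ_zero V hV])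
    (fun V hV => by
      have h1 : |lamV V| ≤ C := by
        obtain ⟨h1, h2⟩ := lamV_mem V hV.1
        have := inv_pos.2 hC0
        exact abs_le.2 ⟨by linarith, h2⟩
      have h2 : |rad V| ≤ 6 * C := by
        have h3 := abs_add_three (r 1) ((V - 1) / 2) (primV ℓ V)
        have h4 : |(V - 1) / 2| ≤ 1 / 2 :=
          abs_le.2 ⟨by linarith [hV.1], by linarith [hV.2]⟩
        have h5 := (abs_primV_le ℓ hV.1).trans ℓ_le
        simp only [rad]
        linarith [h.r_le]
      rw [abs_mul]
      gcongr
      · exact sq_le V hV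
      refine (abs_add_le _ _).trans ?_
      rw [abs_mul, abs_mul, abs_mul]
      gcongr
      · exact χ_le V
      · exact h.f_le V hV.1
      refine (abs_add_le _ _).trans ?_
      rw [abs_mul, abs_mul]
      gcongr
      · exact hχ' V
      · exact h.f_le V hV.1
      · exact χ_le V
      · exact h.abs_derivWithin_f_le hV.1)
  refine ⟨(ℓ, z), mem_admissible (by linarith) (ℓ_le.trans ?_) (z_le.trans ?_) fun V hV => ?_,
    hlam z, fun D U hr hf V hV => ?_⟩
  · nlinarith [mul_nonneg hC0.le hC₁, mul_nonneg (sq_nonneg C) hC₁]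
  · nlinarith [mul_nonneg (sq_nonneg C) hC₁]
  · rw [hlam z V hV]
    exact (lamV_mem V hV).1
  · have hrad (y : ℝ) : D.radius U (ℓ, z) y = rad y := by
      simp only [IngoingData.radius, rad, hr]
    have dg (y : ℝ) (hy : 1 ≤ y) :
        HasDerivWithinAt (fun y => rad y * (χ y * f y) - primV z y) 0 (Ici 1) y := by
      refine (((drad y hy).hasDerivWithinAt.mul ((dχ y).hasDerivWithinAt.mul (ddf y hy))).sub
        (hasDerivAt_primV z (by positivity)).hasDerivWithinAt).congr_deriv ?_
      rw [hz y hy]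
      simp only [Pi.mul_apply]
      field_simp
      ring
    have key := constant_of_has_deriv_right_zero (a := 1) (b := V)
      (fun y hy => (dg y hy.1).continuousWithinAt.mono fun _ h => h.1)
      (fun y hy => (dg y hy.1).mono (Ici_subset_Ici.2 hy.1)) V ⟨hV, le_rfl⟩
    have rad_one : rad 1 = r 1 := by simp [rad, primV_one]
    rw [primV_one, rad_one, hχone] at key
    rw [hrad, IngoingData.rphi, hr, hf]
    linarith

end OutgoingBounds

lemma mk_mem_regSS {k U V : ℝ} (hk : k ^ 2 < 1 / 3) (hU : U ∈ Ioo (-1) 0) (hV : 1 ≤ V) :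
    (U, V) ∈ RegSS k := by
  have h0 : 0 < -U := neg_pos.2 hU.2
  refine ⟨hU.1.le, hU.2, hV, ?_⟩
  rw [one_le_div (Real.rpow_pos_of_pos h0 _)]
  exact (Real.rpow_le_one h0.le (by linarith [hU.1]) (one_div_nonneg.2 (by linarith))).trans hV

namespace IngoingData

variable {D : IngoingData} {B a U : ℝ} {X : ℝ → ConeFun × ConeFun}

lemma admissible_anti {κ κ' B : ℝ} (h : κ ≤ κ') : admissible κ' B ⊆ admissible κ B :=
  fun _ hx => ⟨hx.1, hx.2.1, fun s => h.trans (hx.2.2 s)⟩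

lemma solφ_one (hU : D.r U ≠ 0) : D.solφ X (U, 1) = D.φ U := by
  simp [solφ, rphi, radius, primV_one, hU]

lemma IsEvolution.pu_solR_one (h : D.IsEvolution B a X) (hU : U ∈ Ioo a 0) :
    pu (D.solR X) (U, 1) = D.ν U := by
  rw [h.pu_solR hU, nu, primV_one, add_zero]

end IngoingData

/-- **Asymptotically flat truncation** (Appendix A, Section A.3.1).  Let `k² ∈ (0,1/3)`
and let `(r_s, m_s, φ_s)` be the exact `k`-self-similar exterior solution in the gauge
`U = −|û|^{1−k²}`, `V = v̂`, satisfying the listed self-similar bounds on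
`{V ≥ 1, z ≥ 1}` together with uniformly bounded `C²` data norms on each `{U = const}`.
Let `χ` be a smooth cutoff, `χ = 1` on `[0,1]`, `χ = 0` on `[2,∞)`, `0 ≤ χ ≤ 1`, with
bounded derivatives.  Then there exists `U_min < 0` small (depending only on the
self-similar solution) and a solution `(r,m,φ)` of SSESF on
`Q^(trunc) = {U_min ≤ U < 0, 1 ≤ V < ∞}`, `C¹` away from `{U=0}`, attaining the
truncated characteristic data, with: `r ≍ V`, `−∂_U r ≍ 1`, `∂_V r ≍ 1`,
`0 ≤ μ ≤ c′ < 1`; `|∂_V r − 1/2| ≲ V^{−2}` and `|∂_V(rφ)| ≲ V^{−2}`; existence of the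
limits `ν_∞(U) = lim_{V→∞} ∂_U r(U,V)`, finite, pinched between two negative constants,
with `|∂_U r − ν_∞| ≲ V^{−1}`; asymptotic flatness along each `{U = const}`; and
incompleteness of null infinity: `limsup_{V→∞} ∫_{U_min}^0 Ω² dU < ∞`, where
`Ω² = −4∂_U r·∂_V r/(1−μ)`. -/
theorem asymptotically_flat_truncation
    (k : ℝ) (hk2 : 0 < k ^ 2) (hk2' : k ^ 2 < 1 / 3)
    (rs ms φs : ℝ × ℝ → ℝ) (Cs cs : ℝ) (hCs : 1 ≤ Cs) (hcs : cs < 1)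
    (hsol : SSESF rs ms φs (RegSS k))
    (hreg : ContDiffOn ℝ 2 rs (RegSS k) ∧ ContDiffOn ℝ 2 ms (RegSS k) ∧
      ContDiffOn ℝ 2 φs (RegSS k))
    (hbounds : ∀ q ∈ RegSS k,
      (Cs⁻¹ * q.2 ≤ rs q ∧ rs q ≤ Cs * q.2) ∧
      (Cs⁻¹ * q.2 ^ (k ^ 2) ≤ -pu rs q ∧ -pu rs q ≤ Cs * q.2 ^ (k ^ 2)) ∧
      (Cs⁻¹ ≤ pv rs q ∧ pv rs q ≤ Cs) ∧
      (0 ≤ 2 * ms q / rs q ∧ 2 * ms q / rs q ≤ cs) ∧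
      |pu φs q| ≤ Cs * q.2 ^ (-1 + k ^ 2) ∧
      |pv φs q| ≤ Cs * q.2 ^ (-1 : ℝ) ∧
      |pu (pu rs) q| ≤ Cs * q.2 ^ (-1 + 2 * k ^ 2) ∧
      |pv (pv rs) q| ≤ Cs * q.2 ^ (-1 : ℝ) ∧
      |pu (pu φs) q| ≤ Cs * q.2 ^ (-1 + 2 * k ^ 2)
        * (-q.1) ^ (-(1 - k ^ 2 / (1 - k ^ 2))) ∧
      |pv (pv φs) q| ≤ Cs * q.2 ^ (-2 : ℝ))
    -- uniformly bounded C² data norms on each {U = const}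
    (hdata : ∀ q ∈ RegSS k,
      |φs q| ≤ Cs ∧ |pv φs q| ≤ Cs ∧ |pv (pv φs) q| ≤ Cs ∧
      |pv rs q| ≤ Cs ∧ |pv (pv rs) q| ≤ Cs)
    -- the cutoff
    (χ : ℝ → ℝ) (hχsm : ContDiff ℝ (⊤ : ℕ∞) χ)
    (hχone : ∀ v ∈ Icc (0 : ℝ) 1, χ v = 1)
    (hχzero : ∀ v : ℝ, 2 ≤ v → χ v = 0)
    (hχrange : ∀ v : ℝ, 0 ≤ χ v ∧ χ v ≤ 1)
    (hχbd : ∀ n : ℕ, ∃ Cn : ℝ, ∀ v : ℝ, |iteratedDeriv n χ v| ≤ Cn) :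
    ∃ Umin : ℝ, -1 < Umin ∧ Umin < 0 ∧
    ∃ (r m φ : ℝ × ℝ → ℝ) (C c' : ℝ), 0 < C ∧ c' < 1 ∧
      -- solution of SSESF on the (open) truncated region, C¹ away from {U=0}
      SSESF r m φ {q : ℝ × ℝ | Umin < q.1 ∧ q.1 < 0 ∧ 1 < q.2} ∧
      ContDiffOn ℝ 1 r {q : ℝ × ℝ | Umin ≤ q.1 ∧ q.1 < 0 ∧ 1 ≤ q.2} ∧
      ContDiffOn ℝ 1 m {q : ℝ × ℝ | Umin ≤ q.1 ∧ q.1 < 0 ∧ 1 ≤ q.2} ∧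
      ContDiffOn ℝ 1 φ {q : ℝ × ℝ | Umin ≤ q.1 ∧ q.1 < 0 ∧ 1 ≤ q.2} ∧
      -- truncated characteristic data
      (∀ U ∈ Ico Umin (0 : ℝ), φ (U, 1) = φs (U, 1) ∧ pu r (U, 1) = pu rs (U, 1)) ∧
      (∀ V : ℝ, 1 ≤ V →
        φ (Umin, V) = χ V * φs (Umin, V) ∧
        pv r (Umin, V) = χ V * pv rs (Umin, V) + 1 / 2 * (1 - χ V)) ∧
      -- quantitative bounds
      (∀ q : ℝ × ℝ, Umin < q.1 → q.1 < 0 → 1 < q.2 →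
        (C⁻¹ * q.2 ≤ r q ∧ r q ≤ C * q.2) ∧
        (C⁻¹ ≤ -pu r q ∧ -pu r q ≤ C) ∧
        (C⁻¹ ≤ pv r q ∧ pv r q ≤ C) ∧
        (0 ≤ 2 * m q / r q ∧ 2 * m q / r q ≤ c') ∧
        |pv r q - 1 / 2| ≤ C * q.2 ^ (-2 : ℝ) ∧
        |pv (fun q' => r q' * φ q') q| ≤ C * q.2 ^ (-2 : ℝ)) ∧
      -- the limit ν_∞ of ∂_U r along outgoing cones
      (∃ νinf : ℝ → ℝ,
        (∀ U : ℝ, Umin < U → U < 0 →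
          Tendsto (fun V => pu r (U, V)) atTop (𝓝 (νinf U)) ∧
          C⁻¹ ≤ -νinf U ∧ -νinf U ≤ C) ∧
        (∀ q : ℝ × ℝ, Umin < q.1 → q.1 < 0 → 1 < q.2 →
          |pu r q - νinf q.1| ≤ C * q.2⁻¹)) ∧
      -- asymptotic flatness along each {U = const}
      (∀ U : ℝ, Umin < U → U < 0 →
        Tendsto (fun V => r (U, V)) atTop atTop ∧
        (∃ M : ℝ, Tendsto (fun V => m (U, V)) atTop (𝓝 M)) ∧
        (∃ P : ℝ, Tendsto (fun V => r (U, V) * φ (U, V)) atTop (𝓝 P))) ∧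
      -- incomplete null infinity
      (∃ A : ℝ, ∀ᶠ V in atTop,
        (∫ U in Umin..(0 : ℝ),
          -4 * pv r (U, V) * pu r (U, V) / (1 - 2 * m (U, V) / r (U, V))) ≤ A) := by
  have hmem {U V : ℝ} (hU : U ∈ Ioo (-1 : ℝ) 0) (hV : 1 ≤ V) : (U, V) ∈ RegSS k :=
    mk_mem_regSS hk2' hU hV
  obtain ⟨D, hκ, er, eν, eφ⟩ := exists_ingoingData (r := fun U => rs (U, 1))
    (m := fun U => ms (U, 1)) (φ := fun U => φs (U, 1)) hCs hcs
    (hreg.1.comp (by fun_prop) fun U hU => hmem hU le_rfl)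
    (hreg.2.1.comp (by fun_prop) fun U hU => hmem hU le_rfl)
    (hreg.2.2.comp (by fun_prop) fun U hU => hmem hU le_rfl)
    (fun U hU => by simpa using (hbounds _ (hmem hU le_rfl)).1)
    (fun U hU => by simpa [pu] using (hbounds _ (hmem hU le_rfl)).2.1)
    (fun U hU => by simpa [pu] using (hbounds _ (hmem hU le_rfl)).2.2.2.2.2.2.1)
    (fun U hU => by simpa [pu] using (hbounds _ (hmem hU le_rfl)).2.2.2.2.1)
    (fun U hU => (hbounds _ (hmem hU le_rfl)).2.2.2.1)
    (fun U hU => (hsol _ (hmem hU le_rfl)).2.2.2.1)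
  obtain ⟨C₁, hC₁⟩ := hχbd 1
  obtain ⟨ε, hε, hε', hcurve⟩ := D.exists_curve (32 * Cs ^ 2 * (C₁ + 1))
  have ha : -ε / 2 ∈ Ioo (-1 : ℝ) 0 := ⟨by linarith, by linarith⟩
  have hout : OutgoingBounds Cs (fun V => rs (-ε / 2, V)) (fun V => φs (-ε / 2, V)) :=
    { one_le := hCs
      smooth_r := hreg.1.comp (by fun_prop) fun V hV => hmem ha hV
      smooth_f := hreg.2.2.comp (by fun_prop) fun V hV => hmem ha hV
      r_le := by
        obtain ⟨h1, h2⟩ := (hbounds _ (hmem ha le_rfl)).1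
        rw [mul_one] at h1 h2
        rwa [abs_of_nonneg ((inv_nonneg.2 (by linarith)).trans h1)]
      deriv_r_mem := fun V hV => (hbounds _ (hmem ha hV)).2.2.1
      f_le := fun V hV => (hdata _ (hmem ha hV)).1
      deriv_f_le := fun V hV => (hdata _ (hmem ha hV)).2.1 }
  obtain ⟨x₀, hx₀, hlam, hrphi⟩ := hout.exists_initial_state (hχsm.of_le (by exact_mod_cast le_top))
    (hχone 1 (by norm_num)) hχzero hχrange
    (fun V => by simpa [iteratedDeriv_one] using hC₁ V)
  obtain ⟨X, hX, Xmem, Xderiv⟩ := hcurve (-ε / 2) ⟨by linarith, ha.2⟩ x₀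
    (IngoingData.admissible_anti (by linarith) hx₀)
  have hev : D.IsEvolution (32 * Cs ^ 2 * (C₁ + 1) + 1) (2 * (-ε / 2)) X :=
    ⟨by linarith, Xmem, Xderiv⟩
  obtain ⟨C, hC⟩ := D.exists_dominates (32 * Cs ^ 2 * (C₁ + 1) + 1)
  have hCpos := hC.pos
  have hsub : {q : ℝ × ℝ | -ε / 2 ≤ q.1 ∧ q.1 < 0 ∧ 1 ≤ q.2} ⊆
      Ioo (2 * (-ε / 2)) 0 ×ˢ Ici 1 :=
    fun q hq => ⟨⟨by linarith [hq.1], hq.2.1⟩, hq.2.2⟩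
  have hmem' {U : ℝ} (h1 : -ε / 2 < U) (h2 : U < 0) : U ∈ Ioo (2 * (-ε / 2)) 0 :=
    ⟨by linarith, h2⟩
  refine ⟨-ε / 2, ha.1, ha.2, D.solR X, D.solM X, D.solφ X, 2 * C ^ 3, 1 - C⁻¹ ^ 3,
    by positivity, sub_lt_self _ (by positivity),
    fun q hq => hev.ssesf q (hsub ⟨hq.1.le, hq.2.1, hq.2.2.le⟩), hev.contDiffOn_solR.mono hsub,
    hev.contDiffOn_solM.mono hsub, hev.contDiffOn_solφ.mono hsub, fun U hU => ?_, fun V hV => ?_,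
    fun q h1 h2 h3 => hev.solution_bounds hC (hmem' h1 h2) h3,
    ⟨D.nuInf X, fun U h1 h2 => ⟨hev.tendsto_pu_solR (hmem' h1 h2),
      hev.neg_nuInf_mem hC (hmem' h1 h2)⟩,
      fun q h1 h2 h3 => hev.abs_pu_solR_sub_nuInf_le hC (hmem' h1 h2) h3⟩,
    fun U h1 h2 => ⟨hev.tendsto_solR (hmem' h1 h2), ⟨_, IngoingData.IsEvolution.tendsto_solM⟩,
      ⟨_, hev.tendsto_solR_mul_solφ (hmem' h1 h2)⟩⟩,
    ⟨_, (eventually_gt_atTop 1).mono fun V hV => hev.integral_le hC (by linarith) ha.2 hV⟩⟩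
  · have hU' : U ∈ Ioo (-1 : ℝ) 0 := ⟨ha.1.trans_le hU.1, hU.2⟩
    have hr : D.r U ≠ 0 := (D.κ_pos.trans_le (D.r_ge U ⟨hU'.1.le, hU'.2.le⟩)).ne'
    refine ⟨(IngoingData.solφ_one hr).trans (eφ hU').symm,
      (hev.pu_solR_one ⟨by linarith [hU.1], hU.2⟩).trans (eν hU').symm⟩
  · have hrad := IngoingData.radius_pos (D := D) ⟨ha.1.le, ha.2.le⟩ (Xmem (-ε / 2)) hV
    rw [IngoingData.pv_solR hV, hX, hlam V hV]
    refine ⟨?_, rfl⟩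
    rw [hX] at hrad
    rw [IngoingData.solφ, hX, hrphi D _ (er ha).symm (eφ ha).symm V hV,
      mul_div_cancel_left₀ _ hrad.ne']

end
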